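/- Let p = -1 and 0 < τ < 1/2. Suppose f is continuous on the closed unit disc, f extends holomorphically from every circle {|ζ| = R} for 0 < R ≤ 1, and f extends holomorphically from every circle of radius R ≥ τ contained in the closed unit disc and passing through -1 (i.e., every circle {|ζ - t| = t+1} with τ - 1 ≤ t ≤ 0). Then f is holomorphic on the open unit disc. -/

import Mathlib

open Complex

/-- `f` extends holomorphically from the circle of center `a` and radius `r`. -/
def ExtendsHolomorphically (f : ℂ → ℂ) (a : ℂ) (r : ℝ) : Prop :=
  ∃ g : ℂ → ℂ, ContinuousOn g (Metric.closedBall a r) ∧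
    DifferentiableOn ℂ g (Metric.ball a r) ∧
    ∀ ζ ∈ Metric.sphere a r, g ζ = f ζ



lemma contParam {X : Type*} [TopologicalSpace X] [FirstCountableTopology X] {S : Set X} {a b : ℝ} {F : X → ℝ → ℂ}
    (hF : ContinuousOn (fun p : X × ℝ => F p.1 p.2) (S ×ˢ Set.uIcc a b)) :
    ContinuousOn (fun x => ∫ t in a..b, F x t) S := by
  rw [continuousOn_iff_continuous_domRestrict]
  have hab : min a b ≤ max a b := min_le_max
  have h1 : Continuous (fun p : S × ℝ => F p.1 (Set.projIcc (min a b) (max a b) hab p.2)) := by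
    have : Continuous (fun p : S × ℝ => ((p.1 : X), ((Set.projIcc (min a b) (max a b) hab p.2 : ℝ)))) := by
      fun_prop
    exact hF.comp_continuous this (fun p => ⟨p.1.2, (Set.projIcc (min a b) (max a b) hab p.2).2⟩)
  have h2 := intervalIntegral.continuous_parametric_intervalIntegral_of_continuous'
    (μ := MeasureTheory.volume) (f := fun (x : S) t => F x (Set.projIcc (min a b) (max a b) hab t)) h1 a b
  convert! h2 using 1
  funext x
  apply intervalIntegral.integral_congr
  intro t ht
  have : t ∈ Set.Icc (min a b) (max a b) := ht
  simp [Set.projIcc_of_mem hab this]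

lemma holoParam {k : ℂ → ℝ → ℂ} {u₀ : ℂ} {δ β γ : ℝ} (hδ : 0 < δ)
    (hc : ContinuousOn (fun p : ℂ × ℝ => k p.1 p.2) (Metric.ball u₀ δ ×ˢ Set.uIcc β γ))
    (hd : ∀ s ∈ Set.uIcc β γ, DifferentiableOn ℂ (fun u => k u s) (Metric.ball u₀ δ)) :
    DifferentiableAt ℂ (fun u => ∫ s in β..γ, k u s) u₀ := by
  have hcu : ∀ u ∈ Metric.ball u₀ δ, ContinuousOn (fun s => k u s) (Set.uIcc β γ) := by
    intro u hu
    exact hc.comp (by fun_prop : ContinuousOn (fun s : ℝ => (u, s)) _) (fun s hs => ⟨hu, hs⟩)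
  have hsub : Metric.closedBall u₀ (δ/2) ⊆ Metric.ball u₀ δ :=
    Metric.closedBall_subset_ball (by linarith)
  obtain ⟨M, hM⟩ := ((isCompact_closedBall u₀ (δ/2)).prod (isCompact_uIcc (a := β) (b := γ))).exists_bound_of_continuousOn
    (hc.mono (Set.prod_mono hsub (le_refl _)))
  have hIoc : Set.uIoc β γ ⊆ Set.uIcc β γ := Set.uIoc_subset_uIcc
  have hmeas : ∀ u ∈ Metric.ball u₀ δ, MeasureTheory.AEStronglyMeasurable (fun s => k u s)
      (MeasureTheory.volume.restrict (Set.uIoc β γ)) := fun u hu =>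
    ((hcu u hu).mono hIoc).aestronglyMeasurable measurableSet_uIoc
  have key := intervalIntegral.hasDerivAt_integral_of_dominated_loc_of_deriv_le
    (μ := MeasureTheory.volume) (a := β) (b := γ) (F := k) (F' := fun u s => deriv (fun u => k u s) u)
    (x₀ := u₀) (s := Metric.ball u₀ (δ/4)) (bound := fun _ => M / (δ/4))
    (Metric.ball_mem_nhds _ (by positivity)) ?_ ?_ ?_ ?_ ?_ ?_
  · exact key.2.differentiableAt
  · filter_upwards [Metric.ball_mem_nhds u₀ hδ] with u hu using hmeas u hu
  · exact (hcu u₀ (Metric.mem_ball_self hδ)).intervalIntegrable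
  · -- measurability of derivative
    have hlim : ∀ s ∈ Set.uIcc β γ, Filter.Tendsto (fun n : ℕ => ((δ/(n+2) : ℝ):ℂ)⁻¹ * (k (u₀ + ((δ/(n+2) : ℝ):ℂ)) s - k u₀ s))
        Filter.atTop (nhds (deriv (fun u => k u s) u₀)) := by
      intro s hs
      have hda : HasDerivAt (fun u => k u s) (deriv (fun u => k u s) u₀) u₀ :=
        ((hd s hs).differentiableAt (Metric.ball_mem_nhds _ hδ)).hasDerivAt
      have := hda.tendsto_slope_zero
      have h2 : Filter.Tendsto (fun n : ℕ => ((δ/(n+2) : ℝ):ℂ)) Filter.atTop (nhdsWithin 0 {0}ᶜ) := by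
        rw [tendsto_nhdsWithin_iff]
        constructor
        · have : Filter.Tendsto (fun n : ℕ => (δ/(n+2) : ℝ)) Filter.atTop (nhds 0) := by
            apply Filter.Tendsto.const_div_atTop
            exact Filter.tendsto_atTop_add_const_right _ _ tendsto_natCast_atTop_atTop
          exact_mod_cast (continuous_ofReal.tendsto 0).comp this
        · refine Filter.Eventually.of_forall fun n => ?_
          have : (δ/(n+2) : ℝ) ≠ 0 := by positivity
          simpa using (by exact_mod_cast this : ((δ/(n+2) : ℝ):ℂ) ≠ 0)
      have := this.comp h2
      simpa [Function.comp_def] using this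
    refine aestronglyMeasurable_of_tendsto_ae (u := Filter.atTop)
      (f := fun (n : ℕ) s => ((δ/(n+2) : ℝ):ℂ)⁻¹ * (k (u₀ + ((δ/(n+2) : ℝ):ℂ)) s - k u₀ s)) ?_ ?_
    · intro n
      refine MeasureTheory.AEStronglyMeasurable.const_mul ((hmeas _ ?_).sub (hmeas _ (Metric.mem_ball_self hδ))) _
      rw [Metric.mem_ball, dist_eq_norm, add_sub_cancel_left, Complex.norm_real, Real.norm_of_nonneg (by positivity)]
      apply div_lt_self hδ
      have : (0:ℝ) ≤ n := by positivity
      linarith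
    · refine (MeasureTheory.ae_restrict_iff' measurableSet_uIoc).2 (Filter.Eventually.of_forall fun s hs => hlim s (hIoc hs))
  · refine Filter.Eventually.of_forall fun s hs u hu => ?_
    have hsub2 : Metric.closedBall u (δ/4) ⊆ Metric.closedBall u₀ (δ/2) := by
      apply Metric.closedBall_subset_closedBall'
      have := Metric.mem_ball.1 hu
      linarith
    apply Complex.norm_deriv_le_of_forall_mem_sphere_norm_le (by positivity)
    · apply DifferentiableOn.diffContOnCl
      apply (hd s (hIoc hs)).mono
      rw [closure_ball u (by positivity)]
      exact hsub2.trans hsub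
    · intro z hz
      exact hM (z, s) ⟨hsub2 (Metric.sphere_subset_closedBall hz), hIoc hs⟩
  · exact intervalIntegrable_const
  · refine Filter.Eventually.of_forall fun s hs u hu => ?_
    refine ((hd s (hIoc hs)).differentiableAt (Metric.isOpen_ball.mem_nhds ?_)).hasDerivAt
    exact Metric.ball_subset_ball (by linarith) hu

/-- extension families depend jointly continuously on the parameter -/
lemma familyCont {f : ℂ → ℂ} (hf : ContinuousOn f (Metric.closedBall (0 : ℂ) 1)) {T : Set ℝ}
    {a ρ : ℝ → ℝ} (ha : ContinuousOn a T) (hρ : ContinuousOn ρ T)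
    (hin : ∀ t ∈ T, 0 < ρ t ∧ |a t| + ρ t ≤ 1)
    {E : ℂ → ℝ → ℂ}
    (hEc : ∀ t ∈ T, ContinuousOn (fun ζ => E ζ t) (Metric.closedBall 0 1))
    (hEd : ∀ t ∈ T, DifferentiableOn ℂ (fun ζ => E ζ t) (Metric.ball 0 1))
    (hEb : ∀ t ∈ T, ∀ ζ ∈ Metric.sphere (0:ℂ) 1, E ζ t = f (a t + ρ t * ζ)) :
    ContinuousOn (fun p : ℂ × ℝ => E p.1 p.2) (Metric.closedBall 0 1 ×ˢ T) := by
  rintro ⟨ζ₀, t₀⟩ ⟨hζ₀, ht₀⟩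
  simp only at hζ₀ ht₀
  rw [Metric.continuousWithinAt_iff]
  intro ε hε
  have huc := (isCompact_closedBall (0:ℂ) 1).uniformContinuousOn_of_continuous hf
  rw [Metric.uniformContinuousOn_iff] at huc
  obtain ⟨η, hη, hu⟩ := huc (ε/2) (by positivity)
  obtain ⟨δ₁, hδ₁, h1⟩ := Metric.continuousWithinAt_iff.1 (ha t₀ ht₀) (η/2) (by positivity)
  obtain ⟨δ₂, hδ₂, h2⟩ := Metric.continuousWithinAt_iff.1 (hρ t₀ ht₀) (η/2) (by positivity)
  obtain ⟨δ₃, hδ₃, h3⟩ := Metric.continuousWithinAt_iff.1 (hEc t₀ ht₀ ζ₀ hζ₀) (ε/4) (by positivity)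
  have hmem : ∀ t ∈ T, ∀ ζ ∈ Metric.sphere (0:ℂ) 1, (a t + ρ t * ζ : ℂ) ∈ Metric.closedBall (0:ℂ) 1 := by
    intro t ht ζ hζ
    have hz : ‖ζ‖ = 1 := by simpa using hζ
    rw [mem_closedBall_zero_iff]
    calc ‖(a t + ρ t * ζ : ℂ)‖ ≤ ‖(a t : ℂ)‖ + ‖(ρ t * ζ : ℂ)‖ := norm_add_le _ _
      _ = |a t| + ρ t := by
        rw [norm_mul, hz, Complex.norm_real, Complex.norm_real, Real.norm_eq_abs, Real.norm_of_nonneg (hin t ht).1.le, mul_one]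
      _ ≤ 1 := (hin t ht).2
  refine ⟨min δ₁ (min δ₂ δ₃), by positivity, ?_⟩
  rintro ⟨ζ, t⟩ ⟨hζ, ht⟩ hd
  simp only at hζ ht
  rw [Prod.dist_eq, max_lt_iff] at hd
  simp only [lt_min_iff] at hd
  obtain ⟨⟨-, -, d3⟩, ⟨d1, d2, -⟩⟩ := hd
  have e1 := h1 ht d1
  have e2 := h2 ht d2
  have e3 := h3 hζ d3
  have hmax : ‖E ζ t - E ζ t₀‖ ≤ ε/2 := by
    have hdc : DiffContOnCl ℂ (fun ζ => E ζ t - E ζ t₀) (Metric.ball 0 1) := by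
      refine ⟨(hEd t ht).sub (hEd t₀ ht₀), ?_⟩
      rw [closure_ball _ one_ne_zero]
      exact (hEc t ht).sub (hEc t₀ ht₀)
    refine Complex.norm_le_of_forall_mem_frontier_norm_le Metric.isBounded_ball hdc (C := ε/2) ?_ (z := ζ) (by rwa [closure_ball _ one_ne_zero])
    intro z hz
    rw [frontier_ball _ one_ne_zero] at hz
    show ‖E z t - E z t₀‖ ≤ _
    rw [hEb t ht z hz, hEb t₀ ht₀ z hz, ← dist_eq_norm]
    refine (hu _ (hmem t ht z hz) _ (hmem t₀ ht₀ z hz) ?_).le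
    have hz1 : ‖z‖ = 1 := by simpa using hz
    calc dist (a t + ρ t * z : ℂ) (a t₀ + ρ t₀ * z) = ‖((a t - a t₀ : ℝ) : ℂ) + ((ρ t - ρ t₀ : ℝ):ℂ) * z‖ := by
          rw [dist_eq_norm]; congr 1; push_cast; ring
      _ ≤ |a t - a t₀| + |ρ t - ρ t₀| := by
          refine (norm_add_le _ _).trans ?_
          rw [norm_mul, hz1, Complex.norm_real, Complex.norm_real, mul_one]; rfl
      _ < η := by
          rw [Real.dist_eq] at e1 e2; linarith
  simp only
  rw [dist_eq_norm] at e3 ⊢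
  calc ‖E ζ t - E ζ₀ t₀‖ = ‖(E ζ t - E ζ t₀) + (E ζ t₀ - E ζ₀ t₀)‖ := by ring_nf
    _ ≤ _ := norm_add_le _ _
    _ < ε := by linarith


lemma reparam (k : ℝ → ℂ) (β γ : ℝ) :
    ∫ s in β..γ, k s = ∫ x in (0:ℝ)..1, ((γ - β : ℝ) : ℂ) * k (β + (γ - β) * x) := by
  rw [intervalIntegral.integral_const_mul]
  have := intervalIntegral.smul_integral_comp_add_mul (a := 0) (b := 1) k (γ - β) β
  simp only [mul_zero, add_zero, mul_one, add_sub_cancel, real_smul] at this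
  exact this.symm

lemma primCont {X : Type*} [TopologicalSpace X] [FirstCountableTopology X] {S : Set X} {β : ℝ}
    {γ : X → ℝ} {k : X → ℝ → ℂ}
    (hγ : ContinuousOn γ S) (hβ : ∀ x ∈ S, β ≤ γ x)
    (hk : ContinuousOn (fun p : X × ℝ => k p.1 p.2) {p : X × ℝ | p.1 ∈ S ∧ β ≤ p.2 ∧ p.2 ≤ γ p.1}) :
    ContinuousOn (fun x => ∫ s in β..γ x, k x s) S := by
  have e : (fun x => ∫ s in β..γ x, k x s) = fun x => ∫ t in (0:ℝ)..1, ((γ x - β : ℝ) : ℂ) * k x (β + (γ x - β) * t) := by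
    funext x; exact reparam _ _ _
  rw [e]
  apply contParam (F := fun x t => ((γ x - β : ℝ) : ℂ) * k x (β + (γ x - β) * t))
  have hfst : ContinuousOn (fun p : X × ℝ => γ p.1) (S ×ˢ Set.uIcc 0 1) :=
    hγ.comp continuous_fst.continuousOn (fun p hp => hp.1)
  refine ContinuousOn.mul (continuous_ofReal.comp_continuousOn (hfst.sub continuousOn_const)) ?_
  refine hk.comp (f := fun p : X × ℝ => (p.1, β + (γ p.1 - β) * p.2)) ?_ ?_
  · exact continuous_fst.continuousOn.prodMk (continuousOn_const.add ((hfst.sub continuousOn_const).mul continuous_snd.continuousOn))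
  · rintro ⟨x, t⟩ ⟨hx, ht⟩
    rw [Set.uIcc_of_le zero_le_one] at ht
    have h1 := hβ x hx
    have h2 : 0 ≤ γ x - β := by linarith
    refine ⟨hx, ?_, ?_⟩
    · have := mul_nonneg h2 ht.1
      simp only; linarith
    · have := mul_le_mul_of_nonneg_left ht.2 h2
      simp only; linarith

lemma endDeriv {k : ℂ → ℝ → ℂ} {γ : ℂ → ℝ} {γ' : ℂ →L[ℝ] ℝ} {u₀ : ℂ}
    (hγ : HasFDerivAt γ γ' u₀)
    (hk : ContinuousAt (fun p : ℂ × ℝ => k p.1 p.2) (u₀, γ u₀))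
    (hI : ∀ᶠ u in nhds u₀, IntervalIntegrable (k u) MeasureTheory.volume (γ u₀) (γ u)) :
    HasFDerivAt (fun u => ∫ s in (γ u₀)..(γ u), k u s) (γ'.smulRight (k u₀ (γ u₀))) u₀ := by
  have h1 : HasFDerivAt (fun u => (γ u - γ u₀) • (k u₀ (γ u₀))) (γ'.smulRight (k u₀ (γ u₀))) u₀ :=
    (hγ.sub_const _).smul_const _
  have h2 : HasFDerivAt (fun u => ∫ s in (γ u₀)..(γ u), (k u s - k u₀ (γ u₀))) (0 : ℂ →L[ℝ] ℂ) u₀ := by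
    rw [hasFDerivAt_iff_isLittleO]
    simp only [intervalIntegral.integral_same, sub_zero, zero_apply]
    refine Asymptotics.IsLittleO.trans_isBigO ?_ hγ.isBigO_sub
    rw [Asymptotics.isLittleO_iff]
    intro c hc
    obtain ⟨δ, hδ, hk'⟩ := Metric.continuousAt_iff.1 hk c hc
    have hc1 : ∀ᶠ u in nhds u₀, dist (γ u) (γ u₀) < δ := hγ.continuousAt.eventually (Metric.ball_mem_nhds _ hδ)
    filter_upwards [hc1, Metric.ball_mem_nhds u₀ hδ] with u hu1 hu2
    rw [Real.norm_eq_abs]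
    refine intervalIntegral.norm_integral_le_of_norm_le_const ?_
    intro s hs
    have : dist ((u, s) : ℂ × ℝ) (u₀, γ u₀) < δ := by
      rw [Prod.dist_eq, max_lt_iff]
      refine ⟨hu2, ?_⟩
      refine lt_of_le_of_lt ?_ hu1
      have hs' := Set.uIoc_subset_uIcc hs
      simp only [Real.dist_eq]
      have := Set.abs_sub_left_of_mem_uIcc hs'
      simpa using this
    have := hk' this
    rw [dist_eq_norm] at this
    exact this.le
  have h3 := h2.add h1
  rw [zero_add] at h3
  refine h3.congr_of_eventuallyEq ?_
  filter_upwards [hI] with u hu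
  simp only [Pi.add_apply]
  rw [intervalIntegral.integral_sub hu (by simp), intervalIntegral.integral_const]
  simp

structure Setup (V : Set ℂ) (β : ℝ) (α : ℂ → ℝ) (α' : ℂ → ℂ →L[ℝ] ℝ) (k : ℂ → ℝ → ℂ) : Prop where
  hV : IsOpen V
  pos : ∀ u ∈ V, β < α u
  hα : ∀ u ∈ V, HasFDerivAt α (α' u) u
  hα1 : ContinuousOn (fun u => α' u 1) V
  hαI : ContinuousOn (fun u => α' u I) V
  cont : ContinuousOn (fun p : ℂ × ℝ => k p.1 p.2) {p : ℂ × ℝ | p.1 ∈ V ∧ β ≤ p.2 ∧ p.2 ≤ α p.1}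
  diff : ∀ u ∈ V, ∀ s, β ≤ s → s < α u → DifferentiableAt ℂ (fun u => k u s) u

lemma Setup.hasFDeriv {V : Set ℂ} {β : ℝ} {α : ℂ → ℝ} {α' : ℂ → ℂ →L[ℝ] ℝ} {k : ℂ → ℝ → ℂ}
    (h : Setup V β α α' k) {ε : ℝ} (hε : 0 < ε) {u₀ : ℂ} (hu : u₀ ∈ V) (hlt : β < α u₀ - ε) :
    ∃ A : ℂ →L[ℂ] ℂ, HasFDerivAt (fun u => ∫ s in β..(α u - ε), k u s)
      (A.restrictScalars ℝ + (α' u₀).smulRight (k u₀ (α u₀ - ε))) u₀ := by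
  have hαc : ContinuousAt α u₀ := (h.hα u₀ hu).continuousAt
  obtain ⟨δ, hδ, hb⟩ : ∃ δ > 0, ∀ u ∈ Metric.ball u₀ δ, u ∈ V ∧ α u₀ - ε < α u ∧ β < α u - ε := by
    have h1 : ∀ᶠ u in nhds u₀, u ∈ V ∧ α u₀ - ε < α u ∧ β < α u - ε := by
      filter_upwards [h.hV.mem_nhds hu, hαc.eventually (lt_mem_nhds (by linarith : α u₀ - ε < α u₀)),
        hαc.eventually (lt_mem_nhds (by linarith : β + ε < α u₀))] with u a b c
      exact ⟨a, b, by linarith⟩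
    exact Metric.eventually_nhds_iff_ball.1 h1
  have hle : β ≤ α u₀ - ε := hlt.le
  have hA : DifferentiableAt ℂ (fun u => ∫ s in β..(α u₀ - ε), k u s) u₀ := by
    refine holoParam hδ ?_ ?_
    · refine h.cont.mono ?_
      rintro ⟨u, s⟩ ⟨hu, hs⟩
      rw [Set.uIcc_of_le hle] at hs
      exact ⟨(hb u hu).1, hs.1, hs.2.trans (hb u hu).2.1.le⟩
    · intro s hs u hu
      rw [Set.uIcc_of_le hle] at hs
      exact (h.diff u (hb u hu).1 s hs.1 (hs.2.trans_lt (hb u hu).2.1)).differentiableWithinAt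
  have hIntg : ∀ u ∈ V, ∀ a b, β ≤ a → a ≤ α u → β ≤ b → b ≤ α u → IntervalIntegrable (k u) MeasureTheory.volume a b := by
    intro u hu a b ha1 ha2 hb1 hb2
    apply ContinuousOn.intervalIntegrable
    refine h.cont.comp (f := fun s : ℝ => (u, s)) (by fun_prop) ?_
    intro s hs
    rw [Set.mem_uIcc] at hs
    refine ⟨hu, ?_, ?_⟩ <;> simp only <;> rcases hs with hs | hs <;> linarith [hs.1, hs.2]
  have hB := endDeriv (k := k) (γ := fun u => α u - ε) (u₀ := u₀) ((h.hα u₀ hu).sub_const ε) ?_ ?_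
  · refine ⟨fderiv ℂ (fun u => ∫ s in β..(α u₀ - ε), k u s) u₀, ?_⟩
    refine ((hA.hasFDerivAt.restrictScalars ℝ).add hB).congr_of_eventuallyEq ?_
    filter_upwards [Metric.ball_mem_nhds u₀ hδ] with u hu
    have := hb u hu
    simp only [Pi.add_apply]
    rw [intervalIntegral.integral_add_adjacent_intervals]
    · exact hIntg u this.1 _ _ le_rfl (by linarith) hle this.2.1.le
    · exact hIntg u this.1 _ _ hle this.2.1.le this.2.2.le (by linarith)
  · apply h.cont.continuousAt
    have c1 : ContinuousAt (fun p : ℂ × ℝ => α p.1) (u₀, α u₀ - ε) :=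
      ContinuousAt.comp (f := Prod.fst) (x := (u₀, α u₀ - ε)) (by simpa using hαc) continuousAt_fst
    have c2 : ContinuousAt (fun p : ℂ × ℝ => α p.1 - p.2) (u₀, α u₀ - ε) := c1.sub continuousAt_snd
    have e1 := c2.eventually (lt_mem_nhds (by simp [hε] : 0 < α u₀ - (α u₀ - ε)))
    have e2 := (continuousAt_snd (p := ((u₀, α u₀ - ε) : ℂ × ℝ))).eventually (lt_mem_nhds hlt)
    have e3 := (continuousAt_fst (p := ((u₀, α u₀ - ε) : ℂ × ℝ))).eventually (h.hV.mem_nhds hu)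
    filter_upwards [e1, e2, e3] with p q1 q2 q3
    exact ⟨q3, q2.le, by linarith⟩
  · filter_upwards [Metric.ball_mem_nhds u₀ hδ] with u hu
    have := hb u hu
    exact hIntg u this.1 _ _ hle this.2.1.le this.2.2.le (by linarith)

lemma Setup.rect {V : Set ℂ} {β : ℝ} {α : ℂ → ℝ} {α' : ℂ → ℂ →L[ℝ] ℝ} {k : ℂ → ℝ → ℂ}
    (h : Setup V β α α' k) (z w : ℂ) (hzw : (Set.uIcc (z.re) (w.re)) ×ℂ (Set.uIcc (z.im) (w.im)) ⊆ V) :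
    wedgeIntegral z w (fun u => ∫ s in β..(α u), k u s) + wedgeIntegral w z (fun u => ∫ s in β..(α u), k u s) =
      ∫ x : ℝ in z.re..w.re, ∫ y : ℝ in z.im..w.im,
        (k (x + y * I) (α (x + y * I))) * (I * (α' (x + y * I) 1 : ℝ) - (α' (x + y * I) I : ℝ)) := by
  rw [wedgeIntegral_add_wedgeIntegral_eq]
  set Q := (Set.uIcc (z.re) (w.re)) ×ℂ (Set.uIcc (z.im) (w.im)) with hQ
  have hQc : IsCompact Q := isCompact_uIcc.reProdIm isCompact_uIcc
  have hαc : ContinuousOn α V := fun u hu => (h.hα u hu).continuousAt.continuousWithinAt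
  obtain ⟨m, hm, hmα⟩ : ∃ m > 0, ∀ u ∈ Q, β + m ≤ α u := by
    have hne : Q.Nonempty := ⟨z, by simp [hQ, mem_reProdIm]⟩
    obtain ⟨u, hu, hmin⟩ := hQc.exists_isMinOn hne (hαc.mono hzw)
    refine ⟨α u - β, by linarith [h.pos u (hzw hu)], fun v hv => ?_⟩
    have : α u ≤ α v := hmin hv
    linarith
  have hmem : ∀ x ∈ (Set.uIcc (z.re) (w.re)), ∀ y ∈ (Set.uIcc (z.im) (w.im)), (x + y * I : ℂ) ∈ Q := by
    intro x hx y hy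
    simp [hQ, mem_reProdIm, hx, hy]
  let T : Set ℝ := Set.Ico 0 m
  -- joint continuity of truncated primitive
  have hL : ContinuousOn (fun p : ℝ × ℂ => ∫ s in β..(α p.2 - p.1), k p.2 s) (T ×ˢ Q) := by
    apply primCont (γ := fun p : ℝ × ℂ => α p.2 - p.1) (k := fun p s => k p.2 s)
    · exact ((hαc.mono hzw).comp continuous_snd.continuousOn (fun p hp => hp.2)).sub continuous_fst.continuousOn
    · rintro ⟨e, u⟩ ⟨he, hu⟩
      have := hmα u hu
      have := he.2
      simp only at *; linarith
    · refine h.cont.comp (f := fun p : (ℝ × ℂ) × ℝ => (p.1.2, p.2)) (by fun_prop) ?_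
      rintro ⟨⟨e, u⟩, s⟩ ⟨⟨he, hu⟩, h1, h2⟩
      refine ⟨hzw hu, h1, ?_⟩
      have := he.1
      simp only at *; linarith
  have hR : ContinuousOn (fun p : ℝ × ℂ => (k p.2 (α p.2 - p.1)) * (I * (α' p.2 1 : ℝ) - (α' p.2 I : ℝ))) (T ×ˢ Q) := by
    refine ContinuousOn.mul ?_ ?_
    · refine h.cont.comp (f := fun p : ℝ × ℂ => (p.2, α p.2 - p.1)) ?_ ?_
      · exact continuous_snd.continuousOn.prodMk (((hαc.mono hzw).comp continuous_snd.continuousOn (fun p hp => hp.2)).sub continuous_fst.continuousOn)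
      · rintro ⟨e, u⟩ ⟨he, hu⟩
        have := hmα u hu
        have := he.2
        have := he.1
        refine ⟨hzw hu, ?_, ?_⟩ <;> simp only at * <;> linarith
    · refine ContinuousOn.sub (continuousOn_const.mul ?_) ?_
      · exact continuous_ofReal.comp_continuousOn ((h.hα1.mono hzw).comp continuous_snd.continuousOn (fun p hp => hp.2))
      · exact continuous_ofReal.comp_continuousOn ((h.hαI.mono hzw).comp continuous_snd.continuousOn (fun p hp => hp.2))
  -- both sides as functions of ε
  have side : ∀ (g : ℝ → ℂ) (a b : ℝ), Continuous g → (∀ x ∈ (Set.uIcc (a) (b)), g x ∈ Q) →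
      ContinuousOn (fun e : ℝ => ∫ x in a..b, ∫ s in β..(α (g x) - e), k (g x) s) T := by
    intro g a b hg hgQ
    apply contParam (F := fun (e x : ℝ) => ∫ s in β..(α (g x) - e), k (g x) s)
    exact hL.comp (f := fun p : ℝ × ℝ => (p.1, g p.2)) (by fun_prop) (fun p hp => ⟨hp.1, hgQ _ hp.2⟩)
  let LHS : ℝ → ℂ := fun e => (∫ x : ℝ in z.re..w.re, ∫ s in β..(α (x + z.im * I) - e), k (x + z.im * I) s) -
      (∫ x : ℝ in z.re..w.re, ∫ s in β..(α (x + w.im * I) - e), k (x + w.im * I) s) +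
      I • (∫ y : ℝ in z.im..w.im, ∫ s in β..(α (w.re + y * I) - e), k (w.re + y * I) s) -
      I • (∫ y : ℝ in z.im..w.im, ∫ s in β..(α (z.re + y * I) - e), k (z.re + y * I) s)
  let RHS : ℝ → ℂ := fun e => ∫ x : ℝ in z.re..w.re, ∫ y : ℝ in z.im..w.im,
        (k (x + y * I) (α (x + y * I) - e)) * (I * (α' (x + y * I) 1 : ℝ) - (α' (x + y * I) I : ℝ))
  have hLc : ContinuousOn LHS T := by
    refine (((side _ _ _ (by fun_prop) ?_).sub (side _ _ _ (by fun_prop) ?_)).add ((side _ _ _ (by fun_prop) ?_).const_smul I)).sub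
      ((side _ _ _ (by fun_prop) ?_).const_smul I)
    · exact fun x hx => hmem x hx _ (by simp)
    · exact fun x hx => hmem x hx _ (by simp)
    · exact fun x hx => hmem _ (by simp) _ hx
    · exact fun x hx => hmem _ (by simp) _ hx
  have hRc : ContinuousOn RHS T := by
    apply contParam (F := fun (e x : ℝ) => ∫ y : ℝ in z.im..w.im,
        (k (x + y * I) (α (x + y * I) - e)) * (I * (α' (x + y * I) 1 : ℝ) - (α' (x + y * I) I : ℝ)))
    apply contParam (X := ℝ × ℝ) (F := fun p y =>
        (k (p.2 + y * I) (α (p.2 + y * I) - p.1)) * (I * (α' (p.2 + y * I) 1 : ℝ) - (α' (p.2 + y * I) I : ℝ)))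
    exact hR.comp (f := fun p : (ℝ × ℝ) × ℝ => (p.1.1, (p.1.2 + p.2 * I : ℂ))) (by fun_prop) (fun p hp => ⟨hp.1.1, hmem _ hp.1.2 _ hp.2⟩)
  have heq : ∀ e ∈ Set.Ioo 0 m, LHS e = RHS e := by
    intro e he
    have heT : e ∈ T := ⟨he.1.le, he.2⟩
    have hd : ∀ u ∈ Q, ∃ A : ℂ →L[ℂ] ℂ, HasFDerivAt (fun u => ∫ s in β..(α u - e), k u s)
      (A.restrictScalars ℝ + (α' u).smulRight (k u (α u - e))) u := fun u hu =>
        h.hasFDeriv he.1 (hzw hu) (by linarith [hmα u hu, he.2])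
    choose! A hA using hd
    have key := integral_boundary_rect_of_continuousOn_of_hasFDerivAt_real (fun u => ∫ s in β..(α u - e), k u s)
      (fun u => (A u).restrictScalars ℝ + (α' u).smulRight (k u (α u - e))) z w ?_ ?_ ?_
    · refine Eq.trans key ?_
      simp only [RHS]
      congr 1; funext x; congr 1; funext y
      have : (A (x + y * I)) I = I * (A (x + y * I)) 1 := by
        have := (A (x + y * I)).map_smul I 1
        simpa using this
      simp [this]
      ring
    · exact hL.comp (f := fun u : ℂ => (e, u)) (by fun_prop) (fun u hu => ⟨heT, hu⟩)
    · intro x hx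
      apply hA
      rw [mem_reProdIm] at hx ⊢
      exact ⟨Set.Ioo_subset_Icc_self hx.1, Set.Ioo_subset_Icc_self hx.2⟩
    · refine ContinuousOn.integrableOn_compact hQc ?_
      have : ContinuousOn (fun u : ℂ => (k u (α u - e)) * (I * (α' u 1 : ℝ) - (α' u I : ℝ))) Q :=
        hR.comp (f := fun u : ℂ => (e, u)) (by fun_prop) (fun u hu => ⟨heT, hu⟩)
      refine this.congr ?_
      intro u hu
      have : (A u) I = I * (A u) 1 := by
        have := (A u).map_smul I 1
        simpa using this
      simp [this]
      ring
  have h0 : LHS 0 = RHS 0 := by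
    have h0T : (0:ℝ) ∈ T := ⟨le_rfl, hm⟩
    have l1 : Filter.Tendsto LHS (nhdsWithin 0 (Set.Ioo 0 m)) (nhds (LHS 0)) :=
      (hLc 0 h0T).mono Set.Ioo_subset_Ico_self
    have l2 : Filter.Tendsto RHS (nhdsWithin 0 (Set.Ioo 0 m)) (nhds (RHS 0)) :=
      (hRc 0 h0T).mono Set.Ioo_subset_Ico_self
    have : (nhdsWithin (0:ℝ) (Set.Ioo 0 m)).NeBot := by
      rw [nhdsWithin_Ioo_eq_nhdsGT hm]; infer_instance
    refine tendsto_nhds_unique l1 (l2.congr' ?_)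
    filter_upwards [self_mem_nhdsWithin] with e he using (heq e he).symm
  simpa [LHS, RHS] using h0


lemma vanish {C : ℝ} (hC : 1/2 < C) {J : ℂ → ℂ}
    (hd : DifferentiableOn ℂ J {u | 1/2 < u.re ∧ u.re < C ∧ u.im < 0})
    (hc : ContinuousOn J {u | 1/2 ≤ u.re ∧ u.re < C ∧ u.im < 0})
    (h0 : ∀ u : ℂ, u.re = 1/2 → u.im < 0 → J u = 0) :
    ∀ u ∈ {u : ℂ | 1/2 < u.re ∧ u.re < C ∧ u.im < 0}, J u = 0 := by
  let S' : Set ℂ := {u | u.re < C ∧ u.im < 0}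
  have hS'o : IsOpen S' := (isOpen_lt continuous_re continuous_const).inter (isOpen_lt continuous_im continuous_const)
  have hSo : IsOpen {u : ℂ | 1/2 < u.re ∧ u.re < C ∧ u.im < 0} :=
    (isOpen_lt continuous_const continuous_re).inter hS'o
  let K : ℂ → ℂ := fun u => J ((max u.re (1/2) : ℝ) + u.im * I)
  have hKc : ContinuousOn K S' := by
    refine hc.comp (f := fun u : ℂ => (((max u.re (1/2) : ℝ) : ℂ) + u.im * I)) ?_ ?_
    · exact (by fun_prop : Continuous fun u : ℂ => (((max u.re (1/2) : ℝ) : ℂ) + u.im * I)).continuousOn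
    · rintro u ⟨h1, h2⟩
      simp only [Set.mem_ofPred_eq, add_re, ofReal_re, mul_re, ofReal_im, I_re, I_im, add_im, mul_im]
      refine ⟨by simp, ?_, by simpa using h2⟩
      simp [h1]; linarith
  have hK1 : ∀ u : ℂ, 1/2 ≤ u.re → K u = J u := by
    intro u hu
    simp only [K, max_eq_left hu, re_add_im]
  have hK0 : ∀ u : ℂ, u.re ≤ 1/2 → u.im < 0 → K u = 0 := by
    intro u hu hi
    simp only [K, max_eq_right hu]
    apply h0
    · simp
    · simpa using hi
  have half : ∀ x y₀ y₁ : ℝ, x < C → y₀ < 0 → y₁ < 0 →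
      (∫ t : ℝ in (1/2)..x, K (t + y₀ * I)) - (∫ t : ℝ in (1/2)..x, K (t + y₁ * I)) +
      I • (∫ y : ℝ in y₀..y₁, K (x + y * I)) - I • (∫ y : ℝ in y₀..y₁, K ((1/2 : ℝ) + y * I)) = 0 := by
    intro x y₀ y₁ hx hy₀ hy₁
    have key := integral_boundary_rect_eq_zero_of_continuousOn_of_differentiableOn K
      (⟨1/2, y₀⟩ : ℂ) (⟨x, y₁⟩ : ℂ) ?_ ?_
    · simpa using key
    · apply hKc.mono
      intro u hu
      rw [mem_reProdIm, Set.mem_uIcc, Set.mem_uIcc] at hu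
      obtain ⟨h1, h2⟩ := hu
      constructor
      · rcases h1 with h | h <;> simp only at h <;> linarith [h.1, h.2]
      · rcases h2 with h | h <;> simp only at h <;> linarith [h.1, h.2]
    · rcases le_total (1/2) x with h | h
      · have : Set.EqOn K J (Set.Ioo (min (1/2) x) (max (1/2) x) ×ℂ Set.Ioo (min y₀ y₁) (max y₀ y₁)) := by
          intro u hu
          rw [mem_reProdIm, min_eq_left h] at hu
          exact hK1 u hu.1.1.le
        refine DifferentiableOn.congr (hd.mono ?_) this
        intro u hu
        rw [mem_reProdIm, min_eq_left h, max_eq_right h] at hu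
        exact ⟨hu.1.1, hu.1.2.trans hx, hu.2.2.trans (max_lt hy₀ hy₁)⟩
      · have : Set.EqOn K (fun _ => 0) (Set.Ioo (min (1/2) x) (max (1/2) x) ×ℂ Set.Ioo (min y₀ y₁) (max y₀ y₁)) := by
          intro u hu
          rw [mem_reProdIm, max_eq_left h] at hu
          exact hK0 u hu.1.2.le (hu.2.2.trans (max_lt hy₀ hy₁))
        exact (differentiableOn_const 0).congr this
  have hcons : IsConservativeOn K S' := by
    intro z w hzw
    have hz : z ∈ S' := hzw (by simp [Rectangle, mem_reProdIm])
    have hw : w ∈ S' := hzw (by simp [Rectangle, mem_reProdIm])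
    rw [← add_eq_zero_iff_eq_neg, wedgeIntegral_add_wedgeIntegral_eq]
    have e1 := half z.re z.im w.im hz.1 hz.2 hw.2
    have e2 := half w.re z.im w.im hw.1 hz.2 hw.2
    have hIntg : ∀ a b y : ℝ, a < C → b < C → y < 0 → IntervalIntegrable (fun t : ℝ => K (t + y * I)) MeasureTheory.volume a b := by
      intro a b y ha hb hy
      apply ContinuousOn.intervalIntegrable
      refine hKc.comp (by fun_prop) ?_
      intro t ht
      rw [Set.mem_uIcc] at ht
      refine ⟨?_, by simpa using hy⟩
      simp only [add_re, ofReal_re, mul_re, I_re, mul_zero, ofReal_im, I_im, mul_one, sub_self, add_zero]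
      rcases ht with h | h <;> linarith [h.1, h.2]
    have a1 := intervalIntegral.integral_interval_sub_left (hIntg (1/2) w.re z.im hC hw.1 hz.2) (hIntg (1/2) z.re z.im hC hz.1 hz.2)
    have a2 := intervalIntegral.integral_interval_sub_left (hIntg (1/2) w.re w.im hC hw.1 hw.2) (hIntg (1/2) z.re w.im hC hz.1 hw.2)
    rw [← a1, ← a2]
    linear_combination e2 - e1
  have hKd := (isConservativeOn_and_continuousOn_iff_isDifferentiableOn hS'o).1 ⟨hcons, hKc⟩
  have hconv : Convex ℝ S' := (convex_halfSpace_re_lt C).inter (convex_halfSpace_im_lt 0)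
  have han : AnalyticOnNhd ℂ K S' := hKd.analyticOnNhd hS'o
  have hz0 : (⟨0, -1⟩ : ℂ) ∈ S' := ⟨by simp only; linarith, by simp⟩
  have hev : K =ᶠ[nhds (⟨0, -1⟩ : ℂ)] 0 := by
    have : {u : ℂ | u.re < 1/2 ∧ u.im < 0} ∈ nhds (⟨0, -1⟩ : ℂ) := by
      apply IsOpen.mem_nhds ((isOpen_lt continuous_re continuous_const).inter (isOpen_lt continuous_im continuous_const))
      constructor <;> simp
    filter_upwards [this] with u hu
    exact hK0 u hu.1.le hu.2
  have hzero := han.eqOn_zero_of_preconnected_of_eventuallyEq_zero hconv.isPreconnected hz0 hev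
  intro u hu
  rw [← hK1 u hu.1.le]
  exact hzero ⟨hu.2.1, hu.2.2⟩

/-- The half strip. -/
def HStrip (C : ℝ) : Set ℂ := {u | 1/2 < u.re ∧ u.re < C ∧ u.im < 0}

lemma twoSetups {C : ℝ} (hC : 1/2 < C) {β₁ β₂ : ℝ} {α₁ α₂ : ℂ → ℝ} {α₁' α₂' : ℂ → ℂ →L[ℝ] ℝ} {k₁ k₂ : ℂ → ℝ → ℂ}
    (h₁ : Setup (HStrip C) β₁ α₁ α₁' k₁) (h₂ : Setup (HStrip C) β₂ α₂ α₂' k₂)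
    (hb : ∀ u ∈ HStrip C, k₁ u (α₁ u) * (I * (α₁' u 1 : ℝ) - (α₁' u I : ℝ)) =
      k₂ u (α₂ u) * (I * (α₂' u 1 : ℝ) - (α₂' u I : ℝ)))
    {W : Set ℂ} (hW : W = {u | 1/2 ≤ u.re ∧ u.re < C ∧ u.im ≤ 0 ∧ u ≠ 1})
    (hα₁ : ContinuousOn α₁ W) (hα₂ : ContinuousOn α₂ W)
    (hp₁ : ∀ u ∈ W, β₁ ≤ α₁ u) (hp₂ : ∀ u ∈ W, β₂ ≤ α₂ u)
    (hk₁ : ContinuousOn (fun p : ℂ × ℝ => k₁ p.1 p.2) {p : ℂ × ℝ | p.1 ∈ W ∧ β₁ ≤ p.2 ∧ p.2 ≤ α₁ p.1})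
    (hk₂ : ContinuousOn (fun p : ℂ × ℝ => k₂ p.1 p.2) {p : ℂ × ℝ | p.1 ∈ W ∧ β₂ ≤ p.2 ∧ p.2 ≤ α₂ p.1})
    (hz₁ : ∀ u : ℂ, u.re = 1/2 → α₁ u = β₁) (hz₂ : ∀ u : ℂ, u.re = 1/2 → α₂ u = β₂)
    {x : ℝ} (hx1 : 1 < x) (hxC : x < C) :
    ∫ s in β₁..(α₁ x), k₁ x s = ∫ s in β₂..(α₂ x), k₂ x s := by
  set K₁ : ℂ → ℂ := fun u => ∫ s in β₁..(α₁ u), k₁ u s with hK₁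
  set K₂ : ℂ → ℂ := fun u => ∫ s in β₂..(α₂ u), k₂ u s with hK₂
  have c₁ : ContinuousOn K₁ W := primCont hα₁ hp₁ hk₁
  have c₂ : ContinuousOn K₂ W := primCont hα₂ hp₂ hk₂
  have cW : ContinuousOn (fun u => K₁ u - K₂ u) W := c₁.sub c₂
  have hsub : HStrip C ⊆ W := by
    rintro u ⟨a, b, c⟩
    rw [hW]
    refine ⟨a.le, b, c.le, ?_⟩
    rintro rfl
    simp at c
  have hwsub : ∀ (F G : ℂ → ℂ), ContinuousOn F (HStrip C) → ContinuousOn G (HStrip C) → ∀ z w : ℂ, Rectangle z w ⊆ HStrip C →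
      wedgeIntegral z w (fun u => F u - G u) = wedgeIntegral z w F - wedgeIntegral z w G := by
    intro F G hF hG z w hzw
    have i1 : ∀ F : ℂ → ℂ, ContinuousOn F (HStrip C) → IntervalIntegrable (fun t : ℝ => F (t + z.im * I)) MeasureTheory.volume z.re w.re := by
      intro F hF
      apply ContinuousOn.intervalIntegrable
      refine hF.comp (by fun_prop) ?_
      intro t ht
      apply hzw
      simp [Rectangle, mem_reProdIm, ht]
    have i2 : ∀ F : ℂ → ℂ, ContinuousOn F (HStrip C) → IntervalIntegrable (fun t : ℝ => F (w.re + t * I)) MeasureTheory.volume z.im w.im := by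
      intro F hF
      apply ContinuousOn.intervalIntegrable
      refine hF.comp (by fun_prop) ?_
      intro t ht
      apply hzw
      simp [Rectangle, mem_reProdIm, ht]
    simp only [wedgeIntegral]
    rw [intervalIntegral.integral_sub (i1 F hF) (i1 G hG), intervalIntegral.integral_sub (i2 F hF) (i2 G hG)]
    rw [smul_sub]; ring
  have hcons : IsConservativeOn (fun u => K₁ u - K₂ u) (HStrip C) := by
    intro z w hzw
    have hwz : Rectangle w z ⊆ HStrip C := by
      rw [show Rectangle w z = Rectangle z w by simp [Rectangle, Set.uIcc_comm]]; exact hzw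
    rw [← add_eq_zero_iff_eq_neg, hwsub _ _ (c₁.mono hsub) (c₂.mono hsub) z w hzw, hwsub _ _ (c₁.mono hsub) (c₂.mono hsub) w z hwz]
    have r₁ := h₁.rect z w hzw
    have r₂ := h₂.rect z w hzw
    have : (∫ x : ℝ in z.re..w.re, ∫ y : ℝ in z.im..w.im,
        (k₁ (x + y * I) (α₁ (x + y * I))) * (I * (α₁' (x + y * I) 1 : ℝ) - (α₁' (x + y * I) I : ℝ))) =
      ∫ x : ℝ in z.re..w.re, ∫ y : ℝ in z.im..w.im,
        (k₂ (x + y * I) (α₂ (x + y * I))) * (I * (α₂' (x + y * I) 1 : ℝ) - (α₂' (x + y * I) I : ℝ)) := by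
      apply intervalIntegral.integral_congr
      intro x hx
      apply intervalIntegral.integral_congr
      intro y hy
      apply hb
      apply hzw
      simp [Rectangle, mem_reProdIm, hx, hy]
    rw [← r₁, ← r₂] at this
    linear_combination this
  have hd := (isConservativeOn_and_continuousOn_iff_isDifferentiableOn h₁.hV).1 ⟨hcons, cW.mono hsub⟩
  have hv := vanish hC hd (cW.mono ?_) ?_
  · have hxW : (x : ℂ) ∈ W := by
      rw [hW]
      refine ⟨by simp only [ofReal_re]; linarith, by simpa using hxC, by simp, ?_⟩
      intro h
      have : x = 1 := by exact_mod_cast h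
      linarith
    have hlim := cW x hxW
    have hcl : (nhdsWithin (x : ℂ) (HStrip C)).NeBot := by
      rw [← mem_closure_iff_nhdsWithin_neBot, mem_closure_iff_seq_limit]
      refine ⟨fun n : ℕ => x - ((1 / ((n : ℝ) + 1) : ℝ) : ℂ) * I, ?_, ?_⟩
      · intro n
        have : 0 < 1 / ((n : ℝ) + 1) := by positivity
        refine ⟨?_, ?_, ?_⟩
        · simp; linarith
        · simpa using hxC
        · have e : ((x : ℂ) - ((1 / ((n : ℝ) + 1) : ℝ) : ℂ) * I).im = -(1 / ((n : ℝ) + 1)) := by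
            rw [sub_im, mul_im, ofReal_im, ofReal_re, ofReal_im, I_im, I_re]; ring
          show ((x : ℂ) - ((1 / ((n : ℝ) + 1) : ℝ) : ℂ) * I).im < 0
          rw [e]; linarith
      · have t1 : Filter.Tendsto (fun n : ℕ => ((1 / ((n : ℝ) + 1) : ℝ) : ℂ)) Filter.atTop (nhds ((0 : ℝ) : ℂ)) :=
          (continuous_ofReal.tendsto 0).comp tendsto_one_div_add_atTop_nhds_zero_nat
        simpa using (t1.mul_const I).const_sub (x : ℂ)
    have l1 : Filter.Tendsto (fun u => K₁ u - K₂ u) (nhdsWithin (x : ℂ) (HStrip C)) (nhds (K₁ x - K₂ x)) := hlim.mono hsub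
    have l2 : Filter.Tendsto (fun u => K₁ u - K₂ u) (nhdsWithin (x : ℂ) (HStrip C)) (nhds 0) := by
      refine tendsto_const_nhds.congr' ?_
      filter_upwards [self_mem_nhdsWithin] with u hu using (hv u hu).symm
    exact sub_eq_zero.1 (tendsto_nhds_unique l1 l2)
  · rintro u ⟨a, b, c⟩
    rw [hW]
    refine ⟨a, b, c.le, ?_⟩
    rintro rfl
    simp at c
  · intro u hu _
    simp [K₁, K₂, hz₁ u hu, hz₂ u hu]


structure Fam (C : ℝ) (E₁ E₂ : ℂ → ℝ → ℂ) : Prop where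
  c₁ : ContinuousOn (fun p : ℂ × ℝ => E₁ p.1 p.2) (Metric.closedBall 0 1 ×ˢ Set.Ioc 0 1)
  d₁ : ∀ R ∈ Set.Ioc (0:ℝ) 1, DifferentiableOn ℂ (fun ζ => E₁ ζ R) (Metric.ball 0 1)
  c₂ : ContinuousOn (fun p : ℂ × ℝ => E₂ p.1 p.2) (Metric.closedBall 0 1 ×ˢ Set.Icc (1/2) C)
  d₂ : ∀ c ∈ Set.Icc (1/2) C, DifferentiableOn ℂ (fun ζ => E₂ ζ c) (Metric.ball 0 1)
  mt : ∀ u : ℂ, 1/2 ≤ u.re → u.re ≤ C → u ≠ 1 → E₁ ((1/u-1)/(‖1/u-1‖ : ℝ)) ‖1/u-1‖ = E₂ (2 * (u.re : ℝ)/u - 1) u.re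

noncomputable def ker₁ (E₁ : ℂ → ℝ → ℂ) (q₁ q₂ : ℂ) (u : ℂ) (σ : ℝ) : ℂ :=
  E₁ ((1/u-1) / (√(1-σ) : ℝ)) (√(1-σ)) *
    ((q₁ - q₂) * (1/u-1) / (((1-σ : ℝ) - q₁ * (1/u-1)) * ((1-σ : ℝ) - q₂ * (1/u-1))))

noncomputable def ker₂ (E₂ : ℂ → ℝ → ℂ) (q₁ q₂ : ℂ) (u : ℂ) (c : ℝ) : ℂ :=
  E₂ (2 * (c : ℝ) / u - 1) c *
    (2 * (q₁ - q₂) / ((1 - (1 + q₁) * (2 * c - u)) * (1 - (1 + q₂) * (2 * c - u))))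

lemma alpha_eq {u : ℂ} (hu : u ≠ 0) : 1 - ‖1/u-1‖^2 = (2 * u.re - 1) / normSq u := by
  have h : (1/u - 1) = (1-u)/u := by field_simp
  have hn : normSq u ≠ 0 := by simpa using hu
  rw [h, ← normSq_eq_norm_sq, normSq_div, eq_div_iff hn, sub_mul, div_mul_cancel₀ _ hn]
  simp [normSq_apply]; ring

lemma w_ne {q z : ℂ} {r : ℝ} (hq : 0 < q.im) (hz : 0 ≤ z.im) (hr : 0 < r) : (r : ℂ) - q * z ≠ 0 := by
  intro h
  have h1 : q * z = r := by linear_combination -h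
  have h2 : z = r * q⁻¹ := by
    have : q ≠ 0 := by rintro rfl; simp at hq
    field_simp; linear_combination h1
  rw [h2] at hz
  have hn : 0 < normSq q := by
    rw [normSq_pos]; rintro rfl; simp at hq
  simp [inv_im] at hz
  have : -q.im / normSq q < 0 := by apply div_neg_of_neg_of_pos; linarith; exact hn
  nlinarith

lemma v_ne {q v : ℂ} (hq : 0 < q.im) (hv : 0 ≤ v.im) : 1 - (1 + q) * v ≠ 0 := by
  have := w_ne (q := 1 + q) (z := v) (r := 1) (by simpa using hq) hv one_pos
  simpa using this

lemma z_im {u : ℂ} (hu : u.im ≤ 0) : 0 ≤ (1/u-1).im := by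
  simp [inv_im]
  exact div_nonneg (by linarith) (normSq_nonneg u)

lemma z_ne {u : ℂ} (h0 : u ≠ 0) (hu : u ≠ 1) : (1/u-1) ≠ 0 := by
  intro h
  apply hu
  field_simp at h
  linear_combination -h

lemma disc2 {u : ℂ} {c : ℝ} (hu : u ≠ 0) : ‖2 * (c : ℂ) / u - 1‖^2 = 1 - 4 * c * (u.re - c) / normSq u := by
  have h : (2 * (c : ℂ) / u - 1) = (2 * c - u)/u := by field_simp
  have hn : normSq u ≠ 0 := by simpa using hu
  rw [h, ← normSq_eq_norm_sq, normSq_div, div_eq_iff hn, sub_mul, div_mul_cancel₀ _ hn]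
  simp [normSq_apply]; ring

section
variable {C : ℝ} {E₁ E₂ : ℂ → ℝ → ℂ} {q₁ q₂ : ℂ}

def WW (C : ℝ) : Set ℂ := {u | 1/2 ≤ u.re ∧ u.re < C ∧ u.im ≤ 0 ∧ u ≠ 1}

lemma WW.ne {u : ℂ} (h : u ∈ WW C) : u ≠ 0 := by
  rintro rfl
  have := h.1
  simp at this
  linarith

lemma strip_WW : HStrip C ⊆ WW C := by
  rintro u ⟨a, b, c⟩
  refine ⟨a.le, b, c.le, ?_⟩
  rintro rfl
  simp at c

lemma strip_open : IsOpen (HStrip C) :=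
  (isOpen_lt continuous_const continuous_re).inter
    ((isOpen_lt continuous_re continuous_const).inter (isOpen_lt continuous_im continuous_const))

lemma r_bounds {u : ℂ} (h : u ∈ WW C) {σ : ℝ} (h0 : 0 ≤ σ) (h1 : σ ≤ 1 - ‖1/u-1‖^2) :
    0 < 1 - σ ∧ 0 < √(1-σ) ∧ √(1-σ) ≤ 1 ∧ ‖1/u-1‖ ≤ √(1-σ) := by
  have hz : 0 < ‖1/u-1‖ := norm_pos_iff.2 (z_ne (WW.ne h) h.2.2.2)
  have h2 : 0 < 1 - σ := by nlinarith
  refine ⟨h2, Real.sqrt_pos.2 h2, ?_, ?_⟩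
  · rw [Real.sqrt_le_iff]; constructor <;> linarith
  · apply Real.le_sqrt_of_sq_le; linarith

lemma cont₁ (h : Fam C E₁ E₂) (hq₁ : 0 < q₁.im) (hq₂ : 0 < q₂.im) :
    ContinuousOn (fun p : ℂ × ℝ => ker₁ E₁ q₁ q₂ p.1 p.2) {p : ℂ × ℝ | p.1 ∈ WW C ∧ 0 ≤ p.2 ∧ p.2 ≤ 1 - ‖1/p.1-1‖^2} := by
  have hz : ContinuousOn (fun p : ℂ × ℝ => 1/p.1-1) {p : ℂ × ℝ | p.1 ∈ WW C ∧ 0 ≤ p.2 ∧ p.2 ≤ 1 - ‖1/p.1-1‖^2} := by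
    refine ContinuousOn.sub (continuousOn_const.div continuous_fst.continuousOn ?_) continuousOn_const
    intro p hp
    exact WW.ne hp.1
  have hr : Continuous (fun p : ℂ × ℝ => √(1-p.2)) := by fun_prop
  have hr' : Continuous (fun p : ℂ × ℝ => ((1-p.2 : ℝ) : ℂ)) := by fun_prop
  unfold ker₁
  refine ContinuousOn.mul ?_ (ContinuousOn.div ?_ ?_ ?_)
  · refine h.c₁.comp (f := fun p : ℂ × ℝ => ((1/p.1-1) / (√(1-p.2) : ℝ), √(1-p.2))) ?_ ?_
    · refine ContinuousOn.prodMk (hz.div (continuous_ofReal.comp hr).continuousOn ?_) hr.continuousOn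
      intro p hp
      have := (r_bounds hp.1 hp.2.1 hp.2.2).2.1
      exact_mod_cast this.ne'
    · intro p hp
      obtain ⟨a, b, c, d⟩ := r_bounds hp.1 hp.2.1 hp.2.2
      refine ⟨?_, b, c⟩
      rw [mem_closedBall_zero_iff, norm_div, Complex.norm_real, Real.norm_of_nonneg b.le, div_le_one b]
      exact d
  · exact continuousOn_const.mul hz
  · exact (hr'.continuousOn.sub (continuousOn_const.mul hz)).mul (hr'.continuousOn.sub (continuousOn_const.mul hz))
  · intro p hp
    obtain ⟨a, b, c, d⟩ := r_bounds hp.1 hp.2.1 hp.2.2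
    exact mul_ne_zero (w_ne hq₁ (z_im hp.1.2.2.1) a) (w_ne hq₂ (z_im hp.1.2.2.1) a)

lemma disc2_le {u : ℂ} (h : u ∈ WW C) {c : ℝ} (h0 : 1/2 ≤ c) (h1 : c ≤ u.re) : ‖2 * (c : ℂ) / u - 1‖ ≤ 1 := by
  have hn : 0 < normSq u := by rw [normSq_pos]; exact WW.ne h
  have : ‖2 * (c : ℂ) / u - 1‖^2 ≤ 1 := by
    rw [disc2 (WW.ne h)]
    have : 0 ≤ 4 * c * (u.re - c) / normSq u := div_nonneg (mul_nonneg (by linarith) (by linarith)) hn.le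
    linarith
  nlinarith [norm_nonneg (2 * (c : ℂ) / u - 1)]

lemma disc2_lt {u : ℂ} (h : u ∈ WW C) {c : ℝ} (h0 : 1/2 ≤ c) (h1 : c < u.re) : ‖2 * (c : ℂ) / u - 1‖ < 1 := by
  have hn : 0 < normSq u := by rw [normSq_pos]; exact WW.ne h
  have : ‖2 * (c : ℂ) / u - 1‖^2 < 1 := by
    rw [disc2 (WW.ne h)]
    have : 0 < 4 * c * (u.re - c) / normSq u := div_pos (mul_pos (by linarith) (by linarith)) hn
    linarith
  nlinarith [norm_nonneg (2 * (c : ℂ) / u - 1)]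

lemma cont₂ (h : Fam C E₁ E₂) (hq₁ : 0 < q₁.im) (hq₂ : 0 < q₂.im) :
    ContinuousOn (fun p : ℂ × ℝ => ker₂ E₂ q₁ q₂ p.1 p.2) {p : ℂ × ℝ | p.1 ∈ WW C ∧ 1/2 ≤ p.2 ∧ p.2 ≤ p.1.re} := by
  unfold ker₂
  have hc : Continuous (fun p : ℂ × ℝ => (2 * (p.2 : ℂ))) := by fun_prop
  refine ContinuousOn.mul ?_ (ContinuousOn.div continuousOn_const (by fun_prop) ?_)
  · refine h.c₂.comp (f := fun p : ℂ × ℝ => (2 * (p.2 : ℂ) / p.1 - 1, p.2)) ?_ ?_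
    · refine ContinuousOn.prodMk ((hc.continuousOn.div continuous_fst.continuousOn ?_).sub continuousOn_const) continuous_snd.continuousOn
      intro p hp
      exact WW.ne hp.1
    · intro p hp
      refine ⟨?_, hp.2.1, hp.2.2.trans hp.1.2.1.le⟩
      rw [mem_closedBall_zero_iff]
      exact disc2_le hp.1 hp.2.1 hp.2.2
  · intro p hp
    have : 0 ≤ (2 * (p.2 : ℂ) - p.1).im := by simpa using hp.1.2.2.1
    exact mul_ne_zero (v_ne hq₁ this) (v_ne hq₂ this)

noncomputable def al₁' (u : ℂ) : ℂ →L[ℝ] ℝ :=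
  -((2 : ℝ) • (innerSL ℝ (1/u-1)).comp ((ContinuousLinearMap.toSpanSingleton ℂ (-(u^2)⁻¹) : ℂ →L[ℂ] ℂ).restrictScalars ℝ))

lemma al₁_deriv {u : ℂ} (hu : u ≠ 0) : HasFDerivAt (fun u : ℂ => 1 - ‖1/u-1‖^2) (al₁' u) u := by
  have h1 : HasDerivAt (fun u : ℂ => 1/u - 1) (-(u^2)⁻¹) u := by
    simpa using (hasDerivAt_inv hu).sub_const 1
  have h2 := (h1.hasFDerivAt.restrictScalars ℝ).norm_sq
  have h3 := h2.const_sub 1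
  convert! h3 using 1
  rw [al₁']
  ext
  simp

lemma al₁_apply (u h : ℂ) : al₁' u h = 2 * (starRingEnd ℂ (1/u-1) * (h * (u^2)⁻¹)).re := by
  simp only [al₁']
  simp
  ring

lemma al₁_combo {u : ℂ} (hu : u ≠ 0) : I * (al₁' u 1 : ℝ) - (al₁' u I : ℝ) =
    2 * I * ((1/u-1) / (starRingEnd ℂ u)^2) := by
  rw [al₁_apply, al₁_apply]
  have key : ∀ A : ℂ, I * ((2 * A.re : ℝ) : ℂ) - ((2 * (I * A).re : ℝ) : ℂ) = 2 * I * starRingEnd ℂ A := by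
    intro A
    apply Complex.ext <;> simp
  have e1 : starRingEnd ℂ (1/u-1) * (1 * (u^2)⁻¹) = starRingEnd ℂ (1/u-1) * (u^2)⁻¹ := by ring
  have e2 : starRingEnd ℂ (1/u-1) * (I * (u^2)⁻¹) = I * (starRingEnd ℂ (1/u-1) * (u^2)⁻¹) := by ring
  rw [e1, e2, key]
  simp
  rw [div_eq_mul_inv]

lemma setup₁ (h : Fam C E₁ E₂) (hq₁ : 0 < q₁.im) (hq₂ : 0 < q₂.im) :
    Setup (HStrip C) 0 (fun u : ℂ => 1 - ‖1/u-1‖^2) al₁' (ker₁ E₁ q₁ q₂) where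
  hV := strip_open
  pos := by
    intro u hu
    have h0 := WW.ne (strip_WW hu)
    rw [alpha_eq h0]
    exact div_pos (by linarith [hu.1]) (by rw [normSq_pos]; exact h0)
  hα := fun u hu => al₁_deriv (WW.ne (strip_WW hu))
  hα1 := by
    simp_rw [al₁_apply]
    have : ContinuousOn (fun u : ℂ => starRingEnd ℂ (1/u-1) * (1 * (u^2)⁻¹)) (HStrip C) := by
      intro u hu
      have h0 := WW.ne (strip_WW hu)
      apply ContinuousAt.continuousWithinAt
      have : u^2 ≠ 0 := pow_ne_zero _ h0
      fun_prop (disch := assumption)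
    exact continuousOn_const.mul (continuous_re.comp_continuousOn this)
  hαI := by
    simp_rw [al₁_apply]
    have : ContinuousOn (fun u : ℂ => starRingEnd ℂ (1/u-1) * (I * (u^2)⁻¹)) (HStrip C) := by
      intro u hu
      have h0 := WW.ne (strip_WW hu)
      apply ContinuousAt.continuousWithinAt
      have : u^2 ≠ 0 := pow_ne_zero _ h0
      fun_prop (disch := assumption)
    exact continuousOn_const.mul (continuous_re.comp_continuousOn this)
  cont := (cont₁ h hq₁ hq₂).mono (fun p hp => ⟨strip_WW hp.1, hp.2⟩)
  diff := by
    intro u hu s hs1 hs2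
    have hW := strip_WW hu
    have h0 := WW.ne hW
    obtain ⟨a, b, c, d⟩ := r_bounds hW hs1 hs2.le
    have hz : DifferentiableAt ℂ (fun u : ℂ => 1/u-1) u := by
      fun_prop (disch := assumption)
    unfold ker₁
    refine DifferentiableAt.mul ?_ (DifferentiableAt.div (hz.const_mul _) ?_ ?_)
    · have hd : DifferentiableAt ℂ (fun ζ => E₁ ζ √(1-s)) ((1/u-1) / (√(1-s) : ℝ)) := by
        apply (h.d₁ _ ⟨b, c⟩).differentiableAt
        apply Metric.isOpen_ball.mem_nhds
        rw [mem_ball_zero_iff, norm_div, Complex.norm_real, Real.norm_of_nonneg b.le, div_lt_one b]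
        apply Real.lt_sqrt_of_sq_lt
        linarith
      exact hd.comp (f := fun u : ℂ => (1/u-1) / (√(1-s) : ℝ)) u (hz.div_const _)
    · exact (((hz.const_mul _).const_sub _)).mul ((hz.const_mul _).const_sub _)
    · exact mul_ne_zero (w_ne hq₁ (z_im hW.2.2.1) a) (w_ne hq₂ (z_im hW.2.2.1) a)

lemma setup₂ (h : Fam C E₁ E₂) (hq₁ : 0 < q₁.im) (hq₂ : 0 < q₂.im) :
    Setup (HStrip C) (1/2) re (fun _ => reCLM) (ker₂ E₂ q₁ q₂) where
  hV := strip_open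
  pos := fun u hu => hu.1
  hα := fun u hu => reCLM.hasFDerivAt
  hα1 := continuousOn_const
  hαI := continuousOn_const
  cont := (cont₂ h hq₁ hq₂).mono (fun p hp => ⟨strip_WW hp.1, hp.2⟩)
  diff := by
    intro u hu s hs1 hs2
    have hW := strip_WW hu
    have h0 := WW.ne hW
    have hz : DifferentiableAt ℂ (fun u : ℂ => 2 * (s : ℂ)/u-1) u := by
      fun_prop (disch := assumption)
    unfold ker₂
    refine DifferentiableAt.mul ?_ (DifferentiableAt.div (by fun_prop) (by fun_prop) ?_)
    · have hd : DifferentiableAt ℂ (fun ζ => E₂ ζ s) (2 * (s : ℂ)/u-1) := by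
        apply (h.d₂ _ ⟨hs1, (hs2.trans hu.2.1).le⟩).differentiableAt
        apply Metric.isOpen_ball.mem_nhds
        rw [mem_ball_zero_iff]
        exact disc2_lt hW hs1 hs2
      exact hd.comp (f := fun u : ℂ => 2 * (s : ℂ)/u-1) u hz
    · have : 0 ≤ (2 * (s : ℂ) - u).im := by simpa using hW.2.2.1
      exact mul_ne_zero (v_ne hq₁ this) (v_ne hq₂ this)

lemma matching (h : Fam C E₁ E₂) (hq₁ : 0 < q₁.im) (hq₂ : 0 < q₂.im) :
    ∀ u ∈ HStrip C, ker₁ E₁ q₁ q₂ u (1 - ‖1/u-1‖^2) * (I * (al₁' u 1 : ℝ) - (al₁' u I : ℝ)) =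
      ker₂ E₂ q₁ q₂ u u.re * (I * (reCLM 1 : ℝ) - (reCLM I : ℝ)) := by
  intro u hu
  have hW := strip_WW hu
  have h0 := WW.ne hW
  have hz0 := z_ne h0 hW.2.2.2
  rw [al₁_combo h0, ker₁, ker₂]
  have e1 : √(1 - (1 - ‖1/u-1‖^2)) = ‖1/u-1‖ := by
    rw [sub_sub_cancel, Real.sqrt_sq (norm_nonneg _)]
  rw [e1, h.mt u hW.1 hW.2.1.le hW.2.2.2]
  rw [mul_assoc (E₂ _ _) _ _, mul_assoc (E₂ _ _) _ _]
  congr 1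
  have hv : 2 * (u.re : ℂ) - u = starRingEnd ℂ u := by
    apply Complex.ext <;> simp; ring
  have hzz : (((1 - (1 - ‖1/u-1‖^2) : ℝ)) : ℂ) = (1/u-1) * (1/starRingEnd ℂ u - 1) := by
    rw [sub_sub_cancel, ← normSq_eq_norm_sq, ← mul_conj]
    simp
  rw [hv, hzz]
  set v := starRingEnd ℂ u with hvdef
  have hv0 : v ≠ 0 := by simpa [hvdef] using h0
  have hvi : 0 ≤ v.im := by simpa [hvdef] using hW.2.2.1
  have n1 := v_ne hq₁ hvi
  have n2 := v_ne hq₂ hvi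
  set z := 1/u-1
  have f1 : ∀ q : ℂ, z * (1/v-1) - q * z = z * (1 - (1+q)*v) / v := by
    intro q; field_simp; ring
  rw [f1, f1]
  simp
  field_simp

theorem real_identity (h : Fam C E₁ E₂) (hq₁ : 0 < q₁.im) (hq₂ : 0 < q₂.im) {x : ℝ} (hx1 : 1 < x) (hxC : x < C) :
    ∫ s in (0:ℝ)..(1 - ‖1/(x:ℂ)-1‖^2), ker₁ E₁ q₁ q₂ x s = ∫ s in (1/2:ℝ)..x, ker₂ E₂ q₁ q₂ x s := by
  refine twoSetups (by linarith) (setup₁ h hq₁ hq₂) (setup₂ h hq₁ hq₂) (matching h hq₁ hq₂) (W := WW C) rfl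
    ?_ continuous_re.continuousOn ?_ ?_ (cont₁ h hq₁ hq₂) (cont₂ h hq₁ hq₂) ?_ (fun u hu => hu) hx1 hxC
  · intro u hu
    exact (al₁_deriv (WW.ne hu)).continuousAt.continuousWithinAt
  · intro u hu
    rw [alpha_eq (WW.ne hu)]
    exact div_nonneg (by linarith [hu.1]) (normSq_nonneg _)
  · intro u hu; exact hu.1
  · intro u hu
    have h0 : u ≠ 0 := by rintro rfl; simp at hu
    rw [alpha_eq h0, hu]; simp
end


lemma Fam.conj {C : ℝ} {E₁ E₂ : ℂ → ℝ → ℂ} (h : Fam C E₁ E₂) :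
    Fam C (fun ζ R => starRingEnd ℂ (E₁ (starRingEnd ℂ ζ) R)) (fun ζ c => starRingEnd ℂ (E₂ (starRingEnd ℂ ζ) c)) where
  c₁ := by
    refine continuous_conj.comp_continuousOn ?_
    refine h.c₁.comp (f := fun p : ℂ × ℝ => (starRingEnd ℂ p.1, p.2)) ?_ ?_
    · exact ((continuous_conj.comp continuous_fst).prodMk continuous_snd).continuousOn
    · rintro p ⟨h1, h2⟩
      exact ⟨by simpa using h1, h2⟩
  c₂ := by
    refine continuous_conj.comp_continuousOn ?_
    refine h.c₂.comp (f := fun p : ℂ × ℝ => (starRingEnd ℂ p.1, p.2)) ?_ ?_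
    · exact ((continuous_conj.comp continuous_fst).prodMk continuous_snd).continuousOn
    · rintro p ⟨h1, h2⟩
      exact ⟨by simpa using h1, h2⟩
  d₁ := by
    intro R hR ζ hζ
    apply DifferentiableAt.differentiableWithinAt
    have := (h.d₁ R hR).differentiableAt (x := starRingEnd ℂ ζ) (Metric.isOpen_ball.mem_nhds (by simpa using hζ))
    have := this.conj_conj
    simpa [Function.comp_def] using this
  d₂ := by
    intro R hR ζ hζ
    apply DifferentiableAt.differentiableWithinAt
    have := (h.d₂ R hR).differentiableAt (x := starRingEnd ℂ ζ) (Metric.isOpen_ball.mem_nhds (by simpa using hζ))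
    have := this.conj_conj
    simpa [Function.comp_def] using this
  mt := by
    intro u h1 h2 h3
    have := h.mt (starRingEnd ℂ u) (by simpa using h1) (by simpa using h2) (by
      intro hh; apply h3
      have := congrArg (starRingEnd ℂ) hh
      simpa using this)
    have e : 1 / starRingEnd ℂ u - 1 = starRingEnd ℂ (1/u-1) := by simp
    have e3 : (starRingEnd ℂ) 2 = 2 := Complex.conj_ofNat 2
    rw [e, Complex.norm_conj] at this
    simp only [map_div₀, map_sub, map_mul, map_one, conj_ofReal, conj_re] at this ⊢
    rw [e3, this]

lemma intConj (k : ℝ → ℂ) (a b : ℝ) : ∫ s in a..b, starRingEnd ℂ (k s) = starRingEnd ℂ (∫ s in a..b, k s) := by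
  simp only [intervalIntegral, map_sub, integral_conj]

lemma conj_identity {C : ℝ} {E₁ E₂ : ℂ → ℝ → ℂ} {q₁ q₂ : ℂ}
    (h : Fam C E₁ E₂) (hq₁ : q₁.im < 0) (hq₂ : q₂.im < 0) {x : ℝ} (hx1 : 1 < x) (hxC : x < C) :
    ∫ s in (0:ℝ)..(1 - ‖1/(x:ℂ)-1‖^2), ker₁ E₁ q₁ q₂ x s = ∫ s in (1/2:ℝ)..x, ker₂ E₂ q₁ q₂ x s := by
  have := real_identity h.conj (q₁ := starRingEnd ℂ q₁) (q₂ := starRingEnd ℂ q₂) (by simpa using hq₁) (by simpa using hq₂) hx1 hxC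
  have := congrArg (starRingEnd ℂ) this
  rw [← intConj, ← intConj] at this
  have e3 : (starRingEnd ℂ) 2 = 2 := Complex.conj_ofNat 2
  simpa [ker₁, ker₂, e3] using this

lemma poisson {h : ℝ → ℂ} {A B x : ℝ} (hc : ContinuousOn h (Set.Icc A B)) (h1 : A < x) (h2 : x < B) :
    Filter.Tendsto (fun c : ℝ => ∫ w in A..B, h w * (1/((w:ℂ) - (x + I * (1/c : ℝ))) - 1/((w:ℂ) - (x + I * (-(1/c) : ℝ)))))
      Filter.atTop (nhds (2 * Real.pi * I * h x)) := by
  have hpi := Real.pi_pos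
  have key := tendsto_integral_comp_smul_smul_of_integrable' (μ := (MeasureTheory.volume : MeasureTheory.Measure ℝ))
    (φ := fun x : ℝ => Real.pi⁻¹ * (1+x^2)⁻¹) (g := Set.indicator (Set.Ioc A B) h) (x₀ := x)
    (fun x => by positivity)
    (by rw [MeasureTheory.integral_const_mul, integral_univ_inv_one_add_sq]; field_simp)
    (by
      simp only [Module.finrank_self, pow_one, Real.norm_eq_abs]
      have : Filter.Tendsto (fun x : ℝ => Real.pi⁻¹ * ‖x‖⁻¹) (Bornology.cobounded ℝ) (nhds 0) := by
        simpa using (tendsto_inv_atTop_zero.comp (tendsto_norm_cobounded_atTop (E := ℝ))).const_mul Real.pi⁻¹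
      refine squeeze_zero (fun x => by positivity) (fun x => ?_) this
      rw [Real.norm_eq_abs, mul_left_comm]
      gcongr
      rcases eq_or_ne x 0 with rfl | hx
      · simp
      · have : 0 < |x| := abs_pos.2 hx
        rw [← div_eq_mul_inv, div_le_iff₀ (by positivity), inv_mul_eq_div, le_div_iff₀ this]
        nlinarith [sq_abs x])
    (by
      rw [MeasureTheory.integrable_indicator_iff measurableSet_Ioc]
      exact (hc.integrableOn_Icc).mono_set Set.Ioc_subset_Icc_self)
    (by
      have : ContinuousAt h x := (hc x ⟨h1.le, h2.le⟩).continuousAt (Icc_mem_nhds h1 h2)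
      refine this.congr ?_
      filter_upwards [Ioo_mem_nhds h1 h2] with y hy
      rw [Set.indicator_of_mem (Set.Ioo_subset_Ioc_self hy)])
  have hxm : x ∈ Set.Ioc A B := ⟨h1, h2.le⟩
  rw [Set.indicator_of_mem hxm] at key
  refine (key.const_mul (2 * Real.pi * I)).congr' ?_
  filter_upwards [Filter.eventually_gt_atTop 0] with c hc
  rw [intervalIntegral.integral_of_le (h1.trans h2).le, ← MeasureTheory.integral_const_mul, ← MeasureTheory.integral_indicator measurableSet_Ioc]
  congr 1
  ext w
  by_cases hw : w ∈ Set.Ioc A B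
  · rw [Set.indicator_of_mem hw, Set.indicator_of_mem hw]
    simp only [Module.finrank_self, pow_one, smul_eq_mul, real_smul]
    have n1 : (w:ℂ) - (x + I * (1/c : ℝ)) ≠ 0 := by
      intro h0
      have := congrArg im h0
      simp at this
      exact hc.ne' this
    have n2 : (w:ℂ) - (x + I * (-(1/c) : ℝ)) ≠ 0 := by
      intro h0
      have := congrArg im h0
      simp at this
      exact hc.ne' this
    have n3 : (1 + ((c:ℂ) * (x - w))^2) ≠ 0 := by
      have : (0:ℝ) < 1 + (c * (x-w))^2 := by positivity
      exact_mod_cast this.ne'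
    have n4 : (c : ℂ) ≠ 0 := by exact_mod_cast hc.ne'
    have n5 : (Real.pi : ℂ) ≠ 0 := by exact_mod_cast hpi.ne'
    rw [div_sub_div _ _ n1 n2]
    have e : ((w:ℂ) - (x + I * (1/c : ℝ))) * ((w:ℂ) - (x + I * (-(1/c) : ℝ))) = (1 + ((c:ℂ) * (x - w))^2) / c^2 := by
      push_cast
      field_simp
      ring_nf
      rw [I_sq]; ring
    rw [e]
    push_cast
    field_simp
    ring
  · rw [Set.indicator_of_notMem hw, Set.indicator_of_notMem hw]; simp


lemma sub_ne_of_im (w s : ℝ) {y : ℝ} (hy : y ≠ 0) : (w:ℂ) - (s + I * (y : ℝ)) ≠ 0 := by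
  intro h0
  have := congrArg im h0
  simp at this
  exact hy this

lemma contJ {H : ℝ → ℂ} {A B : ℝ} (hH : ContinuousOn H (Set.Icc A B)) (hAB : A ≤ B) (s : ℝ) {y : ℝ} (hy : y ≠ 0) :
    IntervalIntegrable (fun w : ℝ => H w * (1/((w:ℂ) - (s + I * (y : ℝ))))) MeasureTheory.volume A B := by
  apply ContinuousOn.intervalIntegrable
  rw [Set.uIcc_of_le hAB]
  refine hH.mul (continuousOn_const.div (by fun_prop) ?_)
  intro w _
  exact sub_ne_of_im w s hy

lemma const_step {C : ℝ} {E₁ E₂ : ℂ → ℝ → ℂ} (h : Fam C E₁ E₂) {x a : ℝ} (hx1 : 1 < x) (hxC : x < C)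
    (ha : a = 1 - 1/x) {s₁ s₂ : ℝ} (hs₁ : s₁ ∈ Set.Ioo 0 (1-a^2)) (hs₂ : s₂ ∈ Set.Ioo 0 (1-a^2)) :
    E₁ (-(a:ℂ) / (√(1-s₁) : ℝ)) (√(1-s₁)) = E₁ (-(a:ℂ) / (√(1-s₂) : ℝ)) (√(1-s₂)) := by
  have hx0 : 0 < x := by linarith
  have ha0 : 0 < a := by
    rw [ha, sub_pos, div_lt_one hx0]; exact hx1
  have ha1 : a < 1 := by
    rw [ha]; have : 0 < 1/x := by positivity
    linarith
  have hax : a * x = x - 1 := by rw [ha]; field_simp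
  have hac : (a : ℂ) ≠ 0 := by exact_mod_cast ha0.ne'
  have hz : 1/(x:ℂ) - 1 = -(a:ℂ) := by rw [ha]; push_cast; ring
  have hnz : ‖1/(x:ℂ) - 1‖ = a := by rw [hz, norm_neg, norm_real, Real.norm_of_nonneg ha0.le]
  have hxW : (x:ℂ) ∈ WW C := by
    refine ⟨by simp; linarith, by simpa using hxC, by simp, ?_⟩
    have : x ≠ 1 := hx1.ne'
    exact_mod_cast this
  set H : ℝ → ℂ := fun σ => E₁ (-(a:ℂ) / (√(1-σ) : ℝ)) (√(1-σ)) with hHdef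
  have hB0 : 0 ≤ 1 - a^2 := by nlinarith
  have hb : ∀ σ ∈ Set.Icc 0 (1-a^2), 0 < √(1-σ) ∧ √(1-σ) ≤ 1 ∧ a ≤ √(1-σ) := by
    intro σ hσ
    have := r_bounds hxW hσ.1 (by rw [hnz]; exact hσ.2)
    rw [hnz] at this
    exact this.2
  have hHc : ContinuousOn H (Set.Icc 0 (1-a^2)) := by
    refine h.c₁.comp (f := fun σ : ℝ => (-(a:ℂ) / (√(1-σ) : ℝ), √(1-σ))) ?_ ?_
    · have hr : Continuous (fun σ : ℝ => √(1-σ)) := by fun_prop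
      refine ContinuousOn.prodMk (continuousOn_const.div (continuous_ofReal.comp hr).continuousOn ?_) hr.continuousOn
      intro σ hσ
      have := (hb σ hσ).1
      simpa using this.ne'
    · intro σ hσ
      obtain ⟨b, c, d⟩ := hb σ hσ
      refine ⟨?_, b, c⟩
      rw [mem_closedBall_zero_iff, norm_div, norm_neg, Complex.norm_real, Complex.norm_real, Real.norm_of_nonneg b.le,
        Real.norm_of_nonneg ha0.le, div_le_one b]
      exact d
  let q : ℝ → ℝ → ℂ := fun s y => ((s:ℂ) - 1 + I * (y:ℝ)) / a
  let J : ℝ → ℝ → ℂ := fun s y => ∫ w in (0:ℝ)..(1-a^2), H w * (1/((w:ℂ) - (s + I * (y : ℝ))))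
  let M : ℝ → ℂ := fun y => ∫ c in (1/2:ℝ)..x, ker₂ E₂ (q s₁ y) (q s₂ y) x c
  have hqim : ∀ s y, (q s y).im = y / a := by
    intro s y
    simp only [q]
    rw [div_ofReal_im]; simp
  have hqre : ∀ s y, (q s y).re = (s - 1) / a := by
    intro s y
    simp only [q]
    rw [div_ofReal_re]; simp
  have hM : ∀ y : ℝ, y ≠ 0 → J s₂ y - J s₁ y = M y := by
    intro y hy
    have e : ∫ s in (0:ℝ)..(1 - ‖1/(x:ℂ)-1‖^2), ker₁ E₁ (q s₁ y) (q s₂ y) x s = M y := by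
      rcases lt_or_gt_of_ne hy with hy' | hy'
      · exact conj_identity h (by rw [hqim]; exact div_neg_of_neg_of_pos hy' ha0) (by rw [hqim]; exact div_neg_of_neg_of_pos hy' ha0) hx1 hxC
      · exact real_identity h (by rw [hqim]; exact div_pos hy' ha0) (by rw [hqim]; exact div_pos hy' ha0) hx1 hxC
    rw [← e, hnz]
    simp only [J]
    rw [← intervalIntegral.integral_sub (contJ hHc hB0 s₂ hy) (contJ hHc hB0 s₁ hy)]
    apply intervalIntegral.integral_congr
    intro w hw
    simp only [ker₁, hz, H]
    rw [← mul_sub]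
    congr 1
    have n1 := sub_ne_of_im w s₁ hy
    have n2 := sub_ne_of_im w s₂ hy
    have f : ∀ s, ((1 - w : ℝ) : ℂ) - q s y * (-(a:ℂ)) = -((w:ℂ) - (s + I * (y : ℝ))) := by
      intro s
      simp only [q]
      push_cast
      field_simp
      ring
    rw [f, f, div_sub_div _ _ n2 n1]
    have f2 : (q s₁ y - q s₂ y) * (-(a:ℂ)) = s₂ - s₁ := by
      simp only [q]
      field_simp
      ring
    rw [f2]
    congr 1 <;> ring
  have hMc : Continuous M := by
    rw [← continuousOn_univ]
    apply contParam
    have nn : ∀ s ∈ Set.Ioo 0 (1-a^2), ∀ (y : ℝ), ∀ c ∈ Set.Icc (1/2) x, (1 - (1 + q s y) * (2 * (c:ℂ) - x)) ≠ 0 := by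
      intro s hs y c hc h0
      have h1 := congrArg re h0
      have e1 : (1 - (1 + q s y) * (2 * (c:ℂ) - x)).re = 1 - (1 + (s-1)/a) * (2 * c - x) := by
        simp [hqre]
      rw [e1, zero_re] at h1
      set m := 1 + (s-1)/a with hm
      have hm1 : m * a = a + s - 1 := by rw [hm]; field_simp; ring
      have hm2 : m * x < 1 := by
        have : m < 1 - a := by
          rw [← mul_lt_mul_iff_left₀ ha0, hm1]; nlinarith [hs.2]
        have h3 : (1 - a) * x = 1 := by linarith
        nlinarith
      have hm3 : -1 < m * (x - 1) := by
        rw [← hax, ← mul_assoc, hm1]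
        nlinarith [hs.1]
      obtain ⟨hc1, hc2⟩ := hc
      rcases le_total 0 m with h4 | h4 <;> nlinarith
    have hd : ContinuousOn (fun p : ℝ × ℝ => ((2 * (q s₁ p.1 - q s₂ p.1) / ((1 - (1 + q s₁ p.1) * (2 * (p.2:ℂ) - x)) * (1 - (1 + q s₂ p.1) * (2 * (p.2:ℂ) - x)))))) (Set.univ ×ˢ Set.uIcc (1/2) x) := by
      have hq : ∀ s, Continuous (fun p : ℝ × ℝ => q s p.1) := by
        intro s
        simp only [q]
        fun_prop
      have h1 := hq s₁
      have h2 := hq s₂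
      refine ContinuousOn.div (by fun_prop) (by fun_prop) ?_
      rintro p ⟨-, hp⟩
      rw [Set.uIcc_of_le (by linarith)] at hp
      exact mul_ne_zero (nn s₁ hs₁ _ _ hp) (nn s₂ hs₂ _ _ hp)
    unfold ker₂
    refine ContinuousOn.mul ?_ hd
    refine h.c₂.comp (f := fun p : ℝ × ℝ => (2 * (p.2 : ℂ) / x - 1, p.2)) (by fun_prop) ?_
    rintro p ⟨-, hp⟩
    rw [Set.uIcc_of_le (by linarith)] at hp
    refine ⟨?_, hp.1, hp.2.trans hxC.le⟩
    rw [mem_closedBall_zero_iff]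
    exact disc2_le hxW hp.1 (by simpa using hp.2)
  have lim0 : Filter.Tendsto (fun c : ℝ => M (1/c) - M (-(1/c))) Filter.atTop (nhds 0) := by
    have t1 : Filter.Tendsto (fun c : ℝ => 1/c) Filter.atTop (nhds 0) := by
      simpa using tendsto_inv_atTop_zero (𝕜 := ℝ)
    have t2 : Filter.Tendsto (fun c : ℝ => -(1/c)) Filter.atTop (nhds 0) := by
      simpa using t1.neg
    have := ((hMc.tendsto 0).comp t1).sub ((hMc.tendsto 0).comp t2)
    simpa using this
  have lim1 := (poisson hHc hs₂.1 hs₂.2).sub (poisson hHc hs₁.1 hs₁.2)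
  have hEq := tendsto_nhds_unique_of_eventuallyEq lim1 lim0 (by
    filter_upwards [Filter.eventually_gt_atTop 0] with c hc
    have hc1 : 1/c ≠ 0 := by positivity
    have hc2 : -(1/c) ≠ 0 := neg_ne_zero.2 hc1
    rw [← hM _ hc1, ← hM _ hc2]
    simp only [mul_sub]
    rw [intervalIntegral.integral_sub (contJ hHc hB0 s₂ hc1) (contJ hHc hB0 s₂ hc2),
      intervalIntegral.integral_sub (contJ hHc hB0 s₁ hc1) (contJ hHc hB0 s₁ hc2)]
    simp only [J]
    ring)
  rw [← mul_sub] at hEq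
  have hpi : (2 * (Real.pi:ℂ) * I) ≠ 0 := two_pi_I_ne_zero
  have := (mul_eq_zero.1 hEq).resolve_left hpi
  exact (sub_eq_zero.1 this).symm

lemma const_R {C : ℝ} {E₁ E₂ : ℂ → ℝ → ℂ} (h : Fam C E₁ E₂) (hC : 1 < C) {a : ℝ} (ha0 : 0 < a) (ha1 : a < 1 - 1/C)
    {R : ℝ} (h1 : a < R) (h2 : R < 1) : E₁ (-(a:ℂ)/(R:ℝ)) R = E₁ (-(a:ℂ)/((1:ℝ):ℂ)) 1 := by
  have hC0 : 0 < 1/C := by positivity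
  have hx1 : 1 < 1/(1-a) := by rw [lt_div_iff₀ (by linarith)]; linarith
  have hxC : 1/(1-a) < C := by
    rw [div_lt_iff₀ (by linarith)]
    have : C * (1/C) = 1 := by field_simp
    nlinarith
  have hx : a = 1 - 1/(1/(1-a)) := by simp
  have key : ∀ R' ∈ Set.Ioo a 1, E₁ (-(a:ℂ)/(R':ℝ)) R' = E₁ (-(a:ℂ)/(R:ℝ)) R := by
    intro R' hR'
    have m : ∀ r ∈ Set.Ioo a 1, 1 - r^2 ∈ Set.Ioo 0 (1-a^2) := by
      intro r hr
      constructor <;> nlinarith [hr.1, hr.2]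
    have := const_step h hx1 hxC hx (m R' hR') (m R ⟨h1, h2⟩)
    rwa [sub_sub_cancel, sub_sub_cancel, Real.sqrt_sq (by linarith [hR'.1]), Real.sqrt_sq (by linarith)] at this
  have hc : ContinuousOn (fun r : ℝ => E₁ (-(a:ℂ)/(r:ℝ)) r) (Set.Ioc a 1) := by
    refine h.c₁.comp (f := fun r : ℝ => (-(a:ℂ) / (r : ℝ), r)) ?_ ?_
    · refine ContinuousOn.prodMk (continuousOn_const.div continuous_ofReal.continuousOn ?_) continuousOn_id
      intro r hr
      have : 0 < r := ha0.trans hr.1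
      exact_mod_cast this.ne'
    · intro r hr
      have b : 0 < r := ha0.trans hr.1
      refine ⟨?_, b, hr.2⟩
      rw [mem_closedBall_zero_iff, norm_div, norm_neg, Complex.norm_real, Complex.norm_real, Real.norm_of_nonneg b.le,
        Real.norm_of_nonneg ha0.le, div_le_one b]
      exact hr.1.le
  have ha : a < 1 := by linarith
  have t1 : Filter.Tendsto (fun r : ℝ => E₁ (-(a:ℂ)/(r:ℝ)) r) (nhdsWithin 1 (Set.Ioo a 1)) (nhds (E₁ (-(a:ℂ)/((1:ℝ):ℂ)) 1)) :=
    (hc 1 ⟨ha, le_rfl⟩).mono_left (nhdsWithin_mono _ Set.Ioo_subset_Ioc_self)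
  have t2 : Filter.Tendsto (fun r : ℝ => E₁ (-(a:ℂ)/(r:ℝ)) r) (nhdsWithin 1 (Set.Ioo a 1)) (nhds (E₁ (-(a:ℂ)/(R:ℝ)) R)) := by
    refine tendsto_const_nhds.congr' ?_
    filter_upwards [self_mem_nhdsWithin] with r hr
    exact (key r hr).symm
  have : (nhdsWithin (1:ℝ) (Set.Ioo a 1)).NeBot := right_nhdsWithin_Ioo_neBot ha
  exact tendsto_nhds_unique t2 t1

lemma ident {g G : ℂ → ℂ} {R δ : ℝ} (hR : 0 < R) (hδ : 0 < δ)
    (hg : ContinuousOn g (Metric.closedBall 0 R)) (hgd : DifferentiableOn ℂ g (Metric.ball 0 R))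
    (hG : ContinuousOn G (Metric.closedBall 0 R)) (hGd : DifferentiableOn ℂ G (Metric.ball 0 R))
    (he : ∀ a : ℝ, 0 < a → a < R → a < δ → g (-(a:ℂ)) = G (-(a:ℂ))) :
    Set.EqOn g G (Metric.closedBall 0 R) := by
  have hb : Set.EqOn g G (Metric.ball 0 R) := by
    set b := min R δ / 2 with hbdef
    have hm : 0 < min R δ := lt_min hR hδ
    have hmR : min R δ ≤ R := min_le_left _ _
    have hmδ : min R δ ≤ δ := min_le_right _ _
    have hb0 : 0 < b := by positivity
    refine (hgd.analyticOnNhd Metric.isOpen_ball).eqOn_of_preconnected_of_frequently_eq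
      (hGd.analyticOnNhd Metric.isOpen_ball) (convex_ball 0 R).isPreconnected (z₀ := -(b:ℂ)) ?_ ?_
    · rw [mem_ball_zero_iff, norm_neg, norm_real, Real.norm_of_nonneg hb0.le]; linarith
    · have t : Filter.Tendsto (fun r : ℝ => -(r:ℂ)) (nhdsWithin b (Set.Ioo 0 b)) (nhdsWithin (-(b:ℂ)) {(-(b:ℂ))}ᶜ) := by
        rw [tendsto_nhdsWithin_iff]
        constructor
        · exact (continuous_ofReal.neg.tendsto b).mono_left nhdsWithin_le_nhds
        · filter_upwards [self_mem_nhdsWithin] with r hr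
          have : r ≠ b := hr.2.ne
          simpa using this
      have : (nhdsWithin b (Set.Ioo 0 b)).NeBot := right_nhdsWithin_Ioo_neBot hb0
      refine t.frequently (Filter.Eventually.frequently ?_)
      filter_upwards [self_mem_nhdsWithin] with r hr
      exact he r hr.1 (by linarith [hr.2]) (by linarith [hr.2])
  rw [← closure_ball (0:ℂ) hR.ne'] at hg hG ⊢
  exact hb.of_subset_closure hg hG subset_closure subset_rfl

theorem stmt14 (τ : ℝ) (hτ0 : 0 < τ) (hτ : τ < 1 / 2) (f : ℂ → ℂ)
    (hf : ContinuousOn f (Metric.closedBall (0 : ℂ) 1))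
    (hcirc : ∀ R : ℝ, 0 < R → R ≤ 1 → ExtendsHolomorphically f 0 R)
    (hp : ∀ t : ℝ, τ - 1 ≤ t → t ≤ 0 → ExtendsHolomorphically f (t : ℂ) (t + 1)) :
    DifferentiableOn ℂ f (Metric.ball (0 : ℂ) 1) := by
  unfold ExtendsHolomorphically at hcirc hp
  choose! g hgc hgd hgs using hcirc
  choose! k hkc hkd hks using hp
  set C : ℝ := 1/(2*τ) with hCdef
  have hC : 1 < C := by rw [hCdef, lt_div_iff₀ (by linarith)]; linarith
  have ht : ∀ c ∈ Set.Icc (1/2) C, 0 < c ∧ 0 < 1/(2*c) ∧ τ - 1 ≤ 1/(2*c) - 1 ∧ 1/(2*c) - 1 ≤ 0 := by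
    rintro c ⟨h1, h2⟩
    have hc0 : 0 < c := by linarith
    have h3 : τ ≤ 1/(2*c) := by
      rw [hCdef, le_div_iff₀ (by linarith)] at h2
      rw [le_div_iff₀ (by linarith)]; linarith
    have h4 : 1/(2*c) ≤ 1 := by
      rw [div_le_iff₀ (by linarith)]; linarith
    exact ⟨hc0, by positivity, by linarith, by linarith⟩
  let E₁ : ℂ → ℝ → ℂ := fun ζ R => g R (R * ζ)
  let E₂ : ℂ → ℝ → ℂ := fun ζ c => k (1/(2*c) - 1) (((1/(2*c) - 1 : ℝ) : ℂ) + ((1/(2*c) : ℝ) : ℂ) * ζ)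
  have maps : ∀ (a : ℂ) (r : ℝ), 0 < r → ∀ ζ : ℂ, ‖(a + r * ζ) - a‖ = r * ‖ζ‖ := by
    intro a r hr ζ
    rw [add_sub_cancel_left, norm_mul, norm_real, Real.norm_of_nonneg hr.le]
  have c₁' : ∀ R ∈ Set.Ioc (0:ℝ) 1, ContinuousOn (fun ζ => E₁ ζ R) (Metric.closedBall 0 1) := by
    intro R hR
    refine (hgc R hR.1 hR.2).comp (by fun_prop) ?_
    intro ζ hζ
    rw [mem_closedBall_zero_iff] at hζ ⊢
    have := maps 0 R hR.1 ζ
    simp only [zero_add, sub_zero] at this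
    rw [this]; nlinarith [hR.1]
  have d₁' : ∀ R ∈ Set.Ioc (0:ℝ) 1, DifferentiableOn ℂ (fun ζ => E₁ ζ R) (Metric.ball 0 1) := by
    intro R hR
    refine (hgd R hR.1 hR.2).comp (by fun_prop) ?_
    intro ζ hζ
    rw [mem_ball_zero_iff] at hζ ⊢
    have := maps 0 R hR.1 ζ
    simp only [zero_add, sub_zero] at this
    rw [this]; nlinarith [hR.1]
  have c₂' : ∀ c ∈ Set.Icc (1/2) C, ContinuousOn (fun ζ => E₂ ζ c) (Metric.closedBall 0 1) := by
    intro c hc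
    obtain ⟨h0, h1, h2, h3⟩ := ht c hc
    refine (hkc _ h2 h3).comp (by fun_prop) ?_
    intro ζ hζ
    rw [mem_closedBall_zero_iff] at hζ
    rw [mem_closedBall_iff_norm, maps _ _ h1]
    nlinarith
  have d₂' : ∀ c ∈ Set.Icc (1/2) C, DifferentiableOn ℂ (fun ζ => E₂ ζ c) (Metric.ball 0 1) := by
    intro c hc
    obtain ⟨h0, h1, h2, h3⟩ := ht c hc
    refine (hkd _ h2 h3).comp (by fun_prop) ?_
    intro ζ hζ
    rw [mem_ball_zero_iff] at hζ
    rw [mem_ball_iff_norm, maps _ _ h1]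
    nlinarith
  have s₁' : ∀ R ∈ Set.Ioc (0:ℝ) 1, ∀ ζ ∈ Metric.sphere (0:ℂ) 1, E₁ ζ R = f (R * ζ) := by
    intro R hR ζ hζ
    apply hgs R hR.1 hR.2
    rw [mem_sphere_zero_iff_norm] at hζ ⊢
    have := maps 0 R hR.1 ζ
    simp only [zero_add, sub_zero] at this
    rw [this, hζ, mul_one]
  have s₂' : ∀ c ∈ Set.Icc (1/2) C, ∀ ζ ∈ Metric.sphere (0:ℂ) 1, E₂ ζ c = f (((1/(2*c) - 1 : ℝ) : ℂ) + ((1/(2*c) : ℝ) : ℂ) * ζ) := by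
    intro c hc ζ hζ
    obtain ⟨h0, h1, h2, h3⟩ := ht c hc
    apply hks _ h2 h3
    rw [mem_sphere_zero_iff_norm] at hζ
    rw [mem_sphere_iff_norm, maps _ _ h1, hζ]
    ring
  have fam : Fam C E₁ E₂ := by
    refine ⟨?_, d₁', ?_, d₂', ?_⟩
    · refine familyCont hf (a := fun _ => 0) (ρ := fun R => R) continuousOn_const continuousOn_id ?_ c₁' d₁' ?_
      · intro R hR
        simpa using hR
      · intro R hR ζ hζ
        simpa using s₁' R hR ζ hζ
    · have hcc : ContinuousOn (fun c : ℝ => 1/(2*c)) (Set.Icc (1/2) C) := by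
        refine continuousOn_const.div (by fun_prop) ?_
        intro c hc
        have := (ht c hc).1
        positivity
      refine familyCont hf (a := fun c => 1/(2*c)-1) (ρ := fun c => 1/(2*c)) (hcc.sub continuousOn_const) hcc ?_ c₂' d₂' s₂'
      intro c hc
      obtain ⟨h0, h1, h2, h3⟩ := ht c hc
      refine ⟨h1, ?_⟩
      rw [abs_of_nonpos h3]; linarith
    · intro u h1 h2 h3
      obtain ⟨h4, h5, h6, h7⟩ := ht u.re ⟨h1, h2⟩
      have hu0 : u ≠ 0 := by rintro rfl; simp at h4
      have hz := z_ne hu0 h3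
      have hzp : 0 < ‖1/u-1‖ := norm_pos_iff.2 hz
      have hn : 0 < normSq u := normSq_pos.2 hu0
      have hz1 : ‖1/u-1‖ ≤ 1 := by
        have := alpha_eq hu0
        have h8 : 0 ≤ (2 * u.re - 1) / normSq u := div_nonneg (by linarith) hn.le
        nlinarith
      have hzc : ((‖1/u-1‖ : ℝ) : ℂ) ≠ 0 := by exact_mod_cast hzp.ne'
      rw [s₁' _ ⟨hzp, hz1⟩, s₂' _ ⟨h1, h2⟩]
      · congr 1
        rw [mul_div_cancel₀ _ hzc]
        have : (u.re : ℂ) ≠ 0 := by exact_mod_cast h4.ne'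
        push_cast
        field_simp
        ring
      · rw [mem_sphere_zero_iff_norm]
        have := disc2 (c := u.re) hu0
        simp only [sub_self, mul_zero, zero_div, sub_zero] at this
        exact (pow_eq_one_iff_of_nonneg (norm_nonneg _) two_ne_zero).1 this
      · rw [mem_sphere_zero_iff_norm, norm_div, norm_real, norm_norm, div_self hzp.ne']
  have hC1 : 0 < 1 - 1/C := by
    rw [sub_pos, div_lt_one (by linarith)]; exact hC
  have main : ∀ R : ℝ, 0 < R → R < 1 → Set.EqOn (g R) (g 1) (Metric.closedBall 0 R) := by
    intro R h0 h1
    refine ident h0 hC1 (hgc R h0 h1.le) (hgd R h0 h1.le)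
      ((hgc 1 one_pos le_rfl).mono (Metric.closedBall_subset_closedBall h1.le))
      ((hgd 1 one_pos le_rfl).mono (Metric.ball_subset_ball h1.le)) ?_
    intro a ha haR haC
    have := const_R fam hC ha haC haR h1
    have hRc : (R:ℂ) ≠ 0 := by exact_mod_cast h0.ne'
    simp only [E₁] at this
    rw [mul_div_cancel₀ _ hRc] at this
    simpa using this
  have feq : ∀ z ∈ Metric.ball (0:ℂ) 1, z ≠ 0 → f z = g 1 z := by
    intro z hz hz0
    rw [mem_ball_zero_iff] at hz
    have hzp : 0 < ‖z‖ := norm_pos_iff.2 hz0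
    rw [← hgs ‖z‖ hzp hz.le z (by simp)]
    exact main ‖z‖ hzp hz (by simp)
  have feq' : Set.EqOn f (g 1) (Metric.ball 0 1) := by
    intro z hz
    by_cases hz0 : z = 0
    · subst hz0
      have hnb : Metric.closedBall (0:ℂ) 1 ∈ nhds 0 := Metric.closedBall_mem_nhds _ one_pos
      have t1 := (hf.continuousAt hnb).tendsto.mono_left (nhdsWithin_le_nhds (s := {0}ᶜ))
      have t2 := ((hgc 1 one_pos le_rfl).continuousAt hnb).tendsto.mono_left (nhdsWithin_le_nhds (s := {0}ᶜ))
      refine tendsto_nhds_unique_of_eventuallyEq t1 t2 ?_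
      filter_upwards [self_mem_nhdsWithin, mem_nhdsWithin_of_mem_nhds (Metric.ball_mem_nhds (0:ℂ) one_pos)] with w hw1 hw2
      exact feq w hw2 hw1
    · exact feq z hz hz0
  exact (hgd 1 one_pos le_rfl).congr feq'
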